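/- arXiv:2509.15395 — 9 statements merged into one kernel-verified Lean document; each statement's English description precedes it below -/
import Mathlib

section
/- Assume N > 2D and fix a vertex x ∈ X. Then the subgraph of the Grassmann graph J_q(N,D) induced on the set {y ∈ X : y ∩ x = 0} (the D-th subconstituent with respect to x) is connected. -/
open Module in
theorem gr_between {F V : Type*} [Field F] [AddCommGroup V] [Module F V] [FiniteDimensional F V]
    (U W : Submodule F V) (hUW : U ≤ W) (n : ℕ) (h1 : finrank F U ≤ n) (h2 : n ≤ finrank F W) :
    ∃ H : Submodule F V, U ≤ H ∧ H ≤ W ∧ finrank F H = n := by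
  induction n, h1 using Nat.le_induction with
  | base => exact ⟨U, le_rfl, hUW, rfl⟩
  | succ n hn ih =>
    obtain ⟨H, hU, hW, hH⟩ := ih (by omega)
    have : ¬ W ≤ H := fun h => by
      have := Submodule.finrank_mono h
      omega
    obtain ⟨v, hv, hvH⟩ := SetLike.not_le_iff_exists.1 this
    refine ⟨H ⊔ Submodule.span F {v}, hU.trans le_sup_left, sup_le hW ?_, ?_⟩
    · simpa using hv
    · rw [Submodule.finrank_sup_span_singleton hvH, hH]

open Module in
theorem gr_step {F V : Type*} [Field F] [AddCommGroup V] [Module F V] [FiniteDimensional F V]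
    (D : ℕ) (x y z : Submodule F V) (hy : finrank F y = D) (hz : finrank F z = D)
    (hyx : y ⊓ x = ⊥) (hzx : z ⊓ x = ⊥) (hne : y ≠ z) :
    ∃ y' : Submodule F V, finrank F y' = D ∧ y' ⊓ x = ⊥ ∧ y ≠ y' ∧
      finrank F ↥(y ⊓ y') = D - 1 ∧ finrank F ↥(y ⊓ z) < finrank F ↥(y' ⊓ z) := by
  have hnle : ∀ w : Submodule F V, finrank F w = D → y ≠ w → finrank F ↥(y ⊓ w) < D := by
    intro w hw hn
    rw [← hy]
    apply Submodule.finrank_lt_finrank_of_lt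
    refine lt_of_le_of_ne inf_le_left fun h => hn ?_
    exact Submodule.eq_of_le_of_finrank_eq (inf_eq_left.1 h) (by omega)
  have hzU : ¬ z ≤ (y ⊓ z) ⊔ x := by
    intro h
    have h1 : ((y ⊓ z) ⊔ x) ⊓ z = (y ⊓ z) ⊔ (x ⊓ z) := sup_inf_assoc_of_le x inf_le_right
    rw [inf_eq_right.2 h, inf_comm x z, hzx, sup_bot_eq] at h1
    have h2 : z ≤ y := by rw [h1]; exact inf_le_left
    exact hne (Submodule.eq_of_le_of_finrank_eq h2 (by omega)).symm
  obtain ⟨v, hvz, hvU⟩ := SetLike.not_le_iff_exists.1 hzU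
  obtain ⟨f, hfv, hf⟩ := Submodule.exists_le_ker_of_notMem hvU
  have hlt := hnle z hz hne
  have hH0 : D - 1 ≤ finrank F ↥(y ⊓ LinearMap.ker f) := by
    have h1 := Submodule.finrank_sup_add_finrank_inf_eq y (LinearMap.ker f)
    have h2 := LinearMap.finrank_range_add_finrank_ker f
    have h3 : finrank F (LinearMap.range f) ≤ 1 := by
      simpa using Submodule.finrank_le (LinearMap.range f)
    have h4 := Submodule.finrank_le (y ⊔ LinearMap.ker f)
    omega
  obtain ⟨H, hUH, hHy, hH⟩ := gr_between (y ⊓ z) (y ⊓ LinearMap.ker f)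
    (le_inf inf_le_left (le_sup_left.trans hf)) (D - 1) (by omega) hH0
  have hvH : v ∉ H := fun h => hfv (hHy h).2
  have hvy : v ∉ y := fun h => hvU (Submodule.mem_sup_left ⟨h, hvz⟩)
  have hvy' : v ∈ H ⊔ Submodule.span F {v} :=
    Submodule.mem_sup_right (Submodule.mem_span_singleton_self v)
  have hD' : finrank F ↥(H ⊔ Submodule.span F {v}) = D := by
    rw [Submodule.finrank_sup_span_singleton hvH]; omega
  have hyne : y ≠ H ⊔ Submodule.span F {v} := fun h => hvy (h ▸ hvy')
  refine ⟨H ⊔ Submodule.span F {v}, hD', ?_, hyne, ?_, ?_⟩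
  · rw [eq_bot_iff]
    rintro w ⟨hw, hwx⟩
    obtain ⟨h, hh, s, hs, rfl⟩ := Submodule.mem_sup.1 hw
    obtain ⟨c, rfl⟩ := Submodule.mem_span_singleton.1 hs
    have e1 : f (h + c • v) = 0 := hf (Submodule.mem_sup_right hwx)
    have e2 : f h = 0 := (hHy hh).2
    rw [map_add, e2, map_smul, zero_add, smul_eq_mul] at e1
    have e3 : c = 0 := (mul_eq_zero.1 e1).resolve_right hfv
    subst e3
    rw [zero_smul, add_zero] at hwx ⊢
    rw [← hyx]
    exact ⟨(hHy hh).1, hwx⟩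
  · have h1 := hnle _ hD' hyne
    have h2 : finrank F H ≤ finrank F ↥(y ⊓ (H ⊔ Submodule.span F {v})) :=
      Submodule.finrank_mono (le_inf (hHy.trans inf_le_left) le_sup_left)
    omega
  · apply Submodule.finrank_lt_finrank_of_lt
    refine lt_of_le_of_ne (le_inf (hUH.trans le_sup_left) inf_le_right) fun h => hvy ?_
    have : v ∈ y ⊓ z := h ▸ ⟨hvy', hvz⟩
    exact this.1

/-- Assume `N > 2D` and fix a vertex `x` of the Grassmann graph `J_q(N,D)`. Then the subgraph
induced on the set `{y : y ∩ x = 0}` (the `D`-th subconstituent with respect to `x`)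
is connected. -/
theorem stmt4 (q : ℕ) (F : Type*) [Field F] [Fintype F] (hF : Fintype.card F = q)
    (N D : ℕ) (hD : 1 ≤ D) (hND : 2 * D < N)
    (V : Type*) [AddCommGroup V] [Module F V] [FiniteDimensional F V]
    (hV : Module.finrank F V = N)
    (x : {W : Submodule F V // Module.finrank F ↥W = D}) :
    ((SimpleGraph.fromRel
        (fun y z : {W : Submodule F V // Module.finrank F ↥W = D} =>
          Module.finrank F ↥(y.1 ⊓ z.1) = D - 1)).induce
      {y : {W : Submodule F V // Module.finrank F ↥W = D} | y.1 ⊓ x.1 = ⊥}).Connected := by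
  classical
  rw [SimpleGraph.connected_iff]
  constructor
  · have key : ∀ n : ℕ, ∀ y z : {y : {W : Submodule F V // Module.finrank F ↥W = D} |
        y.1 ⊓ x.1 = ⊥}, D - Module.finrank F ↥(y.1.1 ⊓ z.1.1) ≤ n →
        ((SimpleGraph.fromRel
        (fun y z : {W : Submodule F V // Module.finrank F ↥W = D} =>
          Module.finrank F ↥(y.1 ⊓ z.1) = D - 1)).induce
      {y : {W : Submodule F V // Module.finrank F ↥W = D} | y.1 ⊓ x.1 = ⊥}).Reachable y z := by
      intro n
      induction n with
      | zero =>
        rintro ⟨⟨y, hy⟩, hyx⟩ ⟨⟨z, hz⟩, hzx⟩ h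
        simp only at h
        have h1 : y ⊓ z = y := Submodule.eq_of_le_of_finrank_le inf_le_left (by omega)
        have h2 : y = z := Submodule.eq_of_le_of_finrank_eq (inf_eq_left.1 h1) (by omega)
        subst h2
        exact SimpleGraph.Reachable.refl _
      | succ n ih =>
        rintro ⟨⟨y, hy⟩, hyx⟩ ⟨⟨z, hz⟩, hzx⟩ h
        simp only at h
        by_cases hne : y = z
        · subst hne
          exact SimpleGraph.Reachable.refl _
        obtain ⟨y', h1, h2, h3, h4, h5⟩ := gr_step D x.1 y z hy hz hyx hzx hne
        refine SimpleGraph.Reachable.trans (v := ⟨⟨y', h1⟩, h2⟩) ?_ (ih _ _ ?_)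
        · apply SimpleGraph.Adj.reachable
          rw [SimpleGraph.induce_adj, SimpleGraph.fromRel_adj]
          exact ⟨fun e => h3 (congrArg Subtype.val e), Or.inl h4⟩
        · simp only
          omega
    exact fun y z => key _ y z le_rfl
  · obtain ⟨c, hc⟩ := Submodule.exists_isCompl x.1
    have h1 := Submodule.finrank_add_eq_of_isCompl hc
    have h2 := x.2
    obtain ⟨H, -, hHc, hH⟩ := gr_between ⊥ c bot_le D (by simp) (by omega)
    refine ⟨⟨⟨H, hH⟩, ?_⟩⟩
    exact ((hc.disjoint.symm).mono_left hHc).eq_bot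
end

section
/- Assume N > 2D, fix a vertex x ∈ X, and let α be any subspace of x. Then the subgraph of the Grassmann graph J_q(N,D) induced on the set G_α = {y ∈ X : y ∩ x = α} is connected. -/
open Module in
theorem aux_inter {F V : Type*} [Field F] [AddCommGroup V] [Module F V]
    (P T : Submodule F V) (v : V) (hv : v ∉ P ⊔ T) : (P ⊔ Submodule.span F {v}) ⊓ T ≤ P := by
  rintro u ⟨hu, hT⟩
  obtain ⟨a, ha, b, hb, rfl⟩ := Submodule.mem_sup.1 hu
  obtain ⟨c, rfl⟩ := Submodule.mem_span_singleton.1 hb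
  by_cases hc : c = 0
  · simpa [hc] using ha
  · exfalso
    apply hv
    have h1 : c • v ∈ P ⊔ T := by
      have h2 := Submodule.sub_mem _ (Submodule.mem_sup_right (S := P) hT)
        (Submodule.mem_sup_left (T := T) ha)
      simpa using h2
    exact ((P ⊔ T).smul_mem_iff hc).1 h1

open Module in
theorem aux_between {F V : Type*} [Field F] [AddCommGroup V] [Module F V] [FiniteDimensional F V]
    (A B : Submodule F V) (hAB : A ≤ B) (k : ℕ) (h2 : finrank F A + k ≤ finrank F B) :
    ∃ C : Submodule F V, A ≤ C ∧ C ≤ B ∧ finrank F C = finrank F A + k := by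
  induction k with
  | zero => exact ⟨A, le_rfl, hAB, rfl⟩
  | succ k ih =>
    obtain ⟨C, h1, h3, h4⟩ := ih (by omega)
    have hn : ¬ B ≤ C := fun h => by
      have := Submodule.finrank_mono h
      omega
    obtain ⟨v, hvB, hvC⟩ := SetLike.not_le_iff_exists.1 hn
    refine ⟨C ⊔ Submodule.span F {v}, h1.trans le_sup_left, sup_le h3 ?_, ?_⟩
    · simpa using hvB
    · rw [Submodule.finrank_sup_span_singleton hvC]; omega

theorem aux_avoid {F V : Type*} [Field F] [AddCommGroup V] [Module F V]
    (A B : Submodule F V) (hA : A ≠ ⊤) (hB : B ≠ ⊤) : ∃ v, v ∉ A ∧ v ∉ B := by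
  by_contra! h
  obtain ⟨a, ha⟩ : ∃ a, a ∉ A := by
    by_contra! h'
    exact hA (eq_top_iff.2 fun a _ => h' a)
  obtain ⟨b, hb⟩ : ∃ a, a ∉ B := by
    by_contra! h'
    exact hB (eq_top_iff.2 fun a _ => h' a)
  have haB := h a ha
  have hbA : b ∈ A := by
    by_contra h'
    exact hb (h b h')
  have h1 : a + b ∉ A := fun h' => ha (by simpa using A.sub_mem h' hbA)
  exact hb (by simpa using B.sub_mem (h _ h1) haB)

open Module in
theorem aux_exch {F V : Type*} [Field F] [AddCommGroup V] [Module F V] [FiniteDimensional F V]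
    (D : ℕ) (y x w : Submodule F V) (v : V) (hy : finrank F y = D)
    (hw : w ≤ y) (hwD : finrank F w < D) (hx : y ⊓ x ≤ w) (hv : v ∉ y ⊔ x) :
    ∃ y1 : Submodule F V, finrank F y1 = D ∧ y1 ⊓ x = y ⊓ x ∧ w ≤ y1 ∧ v ∈ y1 ∧
      finrank F (y ⊓ y1 : Submodule F V) = D - 1 ∧ y ≠ y1 := by
  obtain ⟨P, h1, h2, h3⟩ := aux_between w y hw (D - 1 - finrank F w) (by omega)
  have hvy : v ∉ y := fun h => hv (Submodule.mem_sup_left h)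
  have hvP : v ∉ P := fun h => hvy (h2 h)
  have hvm : v ∈ P ⊔ Submodule.span F {v} :=
    Submodule.mem_sup_right (Submodule.mem_span_singleton_self v)
  refine ⟨P ⊔ Submodule.span F {v}, ?_, ?_, h1.trans le_sup_left, hvm, ?_, ?_⟩
  · rw [Submodule.finrank_sup_span_singleton hvP]; omega
  · apply le_antisymm
    · refine le_inf ((aux_inter P x v fun h => hv (sup_le_sup_right h2 x h)).trans h2) inf_le_right
    · exact le_inf ((hx.trans h1).trans le_sup_left) inf_le_right
  · have : y ⊓ (P ⊔ Submodule.span F {v}) = P := by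
      apply le_antisymm
      · rw [inf_comm]
        exact aux_inter P y v (by rwa [sup_eq_right.2 h2])
      · exact le_inf h2 le_sup_left
    rw [this]; omega
  · intro h
    exact hvy (h ▸ hvm)

/-- Assume `N > 2D`, fix a vertex `x` of the Grassmann graph `J_q(N,D)`, and let `α` be any
subspace of `x`. Then the subgraph induced on the set `G_α = {y : y ∩ x = α}` is connected. -/
theorem stmt5 (q : ℕ) (F : Type*) [Field F] [Fintype F] (hF : Fintype.card F = q)
    (N D : ℕ) (hD : 1 ≤ D) (hND : 2 * D < N)
    (V : Type*) [AddCommGroup V] [Module F V] [FiniteDimensional F V]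
    (hV : Module.finrank F V = N)
    (x : {W : Submodule F V // Module.finrank F ↥W = D})
    (α : Submodule F V) (hα : α ≤ x.1) :
    ((SimpleGraph.fromRel
        (fun y z : {W : Submodule F V // Module.finrank F ↥W = D} =>
          Module.finrank F ↥(y.1 ⊓ z.1) = D - 1)).induce
      {y : {W : Submodule F V // Module.finrank F ↥W = D} | y.1 ⊓ x.1 = α}).Connected := by

  classical
  have hx := x.2
  set Γ := ((SimpleGraph.fromRel
        (fun y z : {W : Submodule F V // Module.finrank F ↥W = D} =>
          Module.finrank F ↥(y.1 ⊓ z.1) = D - 1)).induce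
      {y : {W : Submodule F V // Module.finrank F ↥W = D} | y.1 ⊓ x.1 = α}) with hΓ
  have proper : ∀ y : Submodule F V, Module.finrank F y = D → y ⊔ x.1 ≠ ⊤ := by
    intro y hy h
    have h1 := Submodule.finrank_add_le_finrank_add_finrank y x.1
    rw [h, finrank_top] at h1
    omega
  have key : ∀ n : ℕ, ∀ y z : {y : {W : Submodule F V // Module.finrank F ↥W = D} // y ∈
      {y : {W : Submodule F V // Module.finrank F ↥W = D} | y.1 ⊓ x.1 = α}},
      D ≤ Module.finrank F (y.1.1 ⊓ z.1.1 : Submodule F V) + n → Γ.Reachable y z := by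
    intro n
    induction n with
    | zero =>
      rintro ⟨⟨y, hy⟩, hya⟩ ⟨⟨z, hz⟩, hza⟩ h
      simp only [add_zero] at h
      have e1 : y ⊓ z = y := Submodule.eq_of_le_of_finrank_le inf_le_left (by omega)
      have e2 : y ⊓ z = z := Submodule.eq_of_le_of_finrank_le inf_le_right (by omega)
      have e : y = z := e1.symm.trans e2
      subst e
      exact SimpleGraph.Reachable.refl _
    | succ n ih =>
      rintro ⟨⟨y, hy⟩, hya⟩ ⟨⟨z, hz⟩, hza⟩ h
      by_cases hlt : Module.finrank F (y ⊓ z : Submodule F V) < D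
      · have hya' : y ⊓ x.1 = α := hya
        have hza' : z ⊓ x.1 = α := hza
        obtain ⟨v, hvy, hvz⟩ := aux_avoid _ _ (proper y hy) (proper z hz)
        have hαw : α ≤ y ⊓ z := le_inf (hya' ▸ inf_le_left) (hza' ▸ inf_le_left)
        obtain ⟨y1, a1, a2, a3, a4, a5, a6⟩ := aux_exch D y x.1 (y ⊓ z) v hy inf_le_left hlt
          (hya'.le.trans hαw) hvy
        obtain ⟨z1, b1, b2, b3, b4, b5, b6⟩ := aux_exch D z x.1 (y ⊓ z) v hz inf_le_right hlt
          (hza'.le.trans hαw) hvz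
        have r1 : Γ.Adj ⟨⟨y, hy⟩, hya⟩ ⟨⟨y1, a1⟩, a2.trans hya'⟩ := by
          simp [hΓ, SimpleGraph.fromRel_adj, a5, a6]
        have r2 : Γ.Adj ⟨⟨z, hz⟩, hza⟩ ⟨⟨z1, b1⟩, b2.trans hza'⟩ := by
          simp [hΓ, SimpleGraph.fromRel_adj, b5, b6]
        refine r1.reachable.trans (SimpleGraph.Reachable.trans (ih _ _ ?_) r2.reachable.symm)
        have hvw : v ∉ y ⊓ z := fun h => hvy (Submodule.mem_sup_left h.1)
        have hle : (y ⊓ z) ⊔ Submodule.span F {v} ≤ y1 ⊓ z1 :=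
          sup_le (le_inf a3 b3) (by simpa using ⟨a4, b4⟩)
        have := Submodule.finrank_mono hle
        rw [Submodule.finrank_sup_span_singleton hvw] at this
        simp only at h ⊢
        omega
      · exact ih _ _ (by simp only; omega)
  have hne : Nonempty {y : {W : Submodule F V // Module.finrank F ↥W = D} // y ∈
      {y : {W : Submodule F V // Module.finrank F ↥W = D} | y.1 ⊓ x.1 = α}} := by
    obtain ⟨C, hC⟩ := Submodule.exists_isCompl x.1
    have h1 := Submodule.finrank_add_eq_of_isCompl hC
    have h2 := Submodule.finrank_mono hα
    obtain ⟨E, -, hE, hE'⟩ := aux_between ⊥ C bot_le (D - Module.finrank F α)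
      (by rw [finrank_bot]; omega)
    rw [finrank_bot] at hE'
    have hd : E ⊓ x.1 = ⊥ := by
      rw [← disjoint_iff]
      exact (hC.disjoint.mono_right hE).symm
    have hd2 : α ⊓ E = ⊥ := by
      rw [← disjoint_iff]
      exact hC.disjoint.mono hα hE
    refine ⟨⟨α ⊔ E, ?_⟩, ?_⟩
    · have := Submodule.finrank_sup_add_finrank_inf_eq α E
      rw [hd2, finrank_bot] at this
      omega
    · change (α ⊔ E) ⊓ x.1 = α
      rw [sup_inf_assoc_of_le E hα, hd, sup_bot_eq]
  exact { preconnected := fun y z => key D y z (Nat.le_add_left _ _), nonempty := hne }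
end

section
/- Assume N > 2D and fix a vertex x ∈ X. Then the family of vectors {α^∨ : α a subspace of x}, indexed by all subspaces α of x, is linearly independent in C^X. -/
open scoped Classical

theorem exists_sub_aux {F V : Type*} [Field F] [AddCommGroup V] [Module F V]
    [FiniteDimensional F V] (C : Submodule F V) (n : ℕ) (hn : n ≤ Module.finrank F C) :
    ∃ W : Submodule F V, W ≤ C ∧ Module.finrank F W = n := by
  let b := Module.finBasis F C
  have hli : LinearIndependent F (fun i : Fin n => (b (Fin.castLE hn i) : V)) := by
    have h1 := b.linearIndependent.map' C.subtype (Submodule.ker_subtype C)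
    exact h1.comp (Fin.castLE hn) (Fin.castLE_injective hn)
  refine ⟨Submodule.span F (Set.range (fun i : Fin n => (b (Fin.castLE hn i) : V))), ?_, ?_⟩
  · rw [Submodule.span_le]
    rintro _ ⟨i, rfl⟩
    exact (b (Fin.castLE hn i)).2
  · rw [finrank_span_eq_card hli, Fintype.card_fin]

theorem exists_y_aux {F V : Type*} [Field F] [AddCommGroup V] [Module F V]
    [FiniteDimensional F V] (D : ℕ) (hND : 2 * D < Module.finrank F V)
    (x : Submodule F V) (hx : Module.finrank F x = D) (γ : Submodule F V) (hγ : γ ≤ x) :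
    ∃ y : Submodule F V, Module.finrank F y = D ∧ y ⊓ x = γ := by
  obtain ⟨C, hC⟩ := Submodule.exists_isCompl x
  have h1 := Submodule.finrank_add_eq_of_isCompl hC
  have h2 := Submodule.finrank_mono hγ
  obtain ⟨W, hWC, hW⟩ := exists_sub_aux C (D - Module.finrank F γ) (by omega)
  have hd : W ⊓ x = ⊥ := (hC.disjoint.symm.mono_left hWC).eq_bot
  have hd' : γ ⊓ W = ⊥ := (hC.disjoint.mono hγ hWC).eq_bot
  refine ⟨γ ⊔ W, ?_, ?_⟩
  · have h3 := Submodule.finrank_sup_add_finrank_inf_eq γ W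
    rw [hd', finrank_bot] at h3
    omega
  · rw [sup_inf_assoc_of_le W hγ, hd, sup_bot_eq]

/-- Assume `N > 2D` and fix a vertex `x` of the Grassmann graph `J_q(N,D)`. Then the family of
vectors `{α^∨ : α a subspace of x}`, indexed by all subspaces `α` of `x`, is linearly
independent in `ℂ^X`, where `α^∨` is the characteristic vector of `H_α = {y : α ⊆ y}`. -/
theorem stmt11 (q : ℕ) (F : Type*) [Field F] [Fintype F] (hF : Fintype.card F = q)
    (N D : ℕ) (hD : 1 ≤ D) (hND : 2 * D < N)
    (V : Type*) [AddCommGroup V] [Module F V] [FiniteDimensional F V]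
    (hV : Module.finrank F V = N)
    (x : Submodule F V) (hx : Module.finrank F ↥x = D) :
    LinearIndependent ℂ
      (fun α : {β : Submodule F V // β ≤ x} =>
        (fun y : {W : Submodule F V // Module.finrank F ↥W = D} =>
          if α.1 ≤ y.1 then (1 : ℂ) else 0)) := by
  rw [linearIndependent_iff']
  intro s g hg
  have key : ∀ γ : Submodule F V, ∀ h : γ ≤ x, (⟨γ, h⟩ : {β : Submodule F V // β ≤ x}) ∈ s →
      g ⟨γ, h⟩ = 0 := by
    intro γ
    induction γ using WellFoundedLT.induction with
    | ind γ ih =>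
      intro h hs
      obtain ⟨y, hy, hyx⟩ := exists_y_aux D (by omega) x hx γ h
      have h1 := congrFun hg ⟨y, hy⟩
      rw [Finset.sum_apply, Finset.sum_eq_single_of_mem _ hs] at h1
      · have hle : γ ≤ y := hyx ▸ inf_le_left
        simpa [hle] using h1
      · rintro ⟨β, hβ⟩ hbs hne
        by_cases hb : β ≤ y
        · have hbγ : β ≤ γ := hyx ▸ le_inf hb hβ
          have hlt : β < γ := lt_of_le_of_ne hbγ (fun e => hne (Subtype.ext e))
          simp [ih β hlt hβ hbs]
        · simp [hb]
  rintro ⟨γ, h⟩ hs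
  exact key γ h hs
end

section
/- Assume N > 2D, fix a vertex x ∈ X, and let α ⊆ x be a subspace with dim α = i. Then A α^∨ = θ_i α^∨ + [D−i+1] Σ_β β^∨, where θ_i = q[D][N−D] − [i][N−i+1] and the sum is over all subspaces β ⊆ α with dim β = i − 1. -/
open scoped Classical

/-- The `q`-integer `[m] = (q^m - 1)/(q - 1)` as a complex number. -/
noncomputable def qC (q : ℕ) (m : ℤ) : ℂ := ((q : ℂ) ^ m - 1) / ((q : ℂ) - 1)

open Module in
theorem gr_Q0 (F : Type*) [Field F] [Fintype F] (M : Type*) [AddCommGroup M] [Module F M]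
    [FiniteDimensional F M] (m : ℕ) (hm : finrank F M = m) :
    (Nat.card {H : Submodule F M // finrank F H = 1} : ℂ) = qC (Fintype.card F) m := by
  rw [← Nat.card_congr (Projectivization.equivSubmodule F M),
    Projectivization.card_of_finrank F M hm]
  have h : (1:ℕ) < Fintype.card F := Fintype.one_lt_card
  have h' : (Fintype.card F : ℂ) ≠ 1 := by exact_mod_cast h.ne'
  rw [qC, zpow_natCast, ← geom_sum_eq h']
  simp

open Module in
theorem gr_Q1 (F : Type*) [Field F] [Fintype F] (M : Type*) [AddCommGroup M] [Module F M]
    [FiniteDimensional F M] (m : ℕ) (hm : finrank F M = m) :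
    (Nat.card {H : Submodule F M // finrank F H + 1 = m} : ℂ) = qC (Fintype.card F) m := by
  rw [← gr_Q0 F (Dual F M) m (by rw [Subspace.dual_finrank_eq, hm])]
  congr 1
  refine Nat.card_congr (Equiv.subtypeEquiv
    ((Subspace.orderIsoFiniteDimensional (K := F) (V := M)).toEquiv.trans OrderDual.ofDual) ?_)
  intro H
  have := Subspace.finrank_add_finrank_dualAnnihilator_eq H
  change _ ↔ finrank F H.dualAnnihilator = 1
  omega

open Module in
theorem gr_mkQ {F : Type*} [Field F] {M : Type*} [AddCommGroup M] [Module F M]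
    [FiniteDimensional F M] (u : Submodule F M) (H : Submodule F (M ⧸ u)) :
    finrank F (H.comap u.mkQ) = finrank F H + finrank F u := by
  have h1 := Submodule.finrank_quotient_add_finrank u
  have h2 := Submodule.finrank_quotient_add_finrank H
  have h3 := Submodule.finrank_quotient_add_finrank (H.comap u.mkQ)
  have h4 : finrank F (M ⧸ (H.comap u.mkQ)) = finrank F ((M ⧸ u) ⧸ H) := by
    have hs : Function.Surjective (H.mkQ ∘ₗ u.mkQ) :=
      H.mkQ_surjective.comp u.mkQ_surjective
    have hk : LinearMap.ker (H.mkQ ∘ₗ u.mkQ) = H.comap u.mkQ := by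
      rw [LinearMap.ker_comp, Submodule.ker_mkQ]
    rw [← hk]
    exact (LinearMap.quotKerEquivOfSurjective _ hs).finrank_eq
  omega

open Module in
theorem gr_Q4 (F : Type*) [Field F] [Fintype F] (M : Type*) [AddCommGroup M] [Module F M]
    [FiniteDimensional F M] (u : Submodule F M) (m : ℕ) (hm : finrank F M = finrank F u + m) :
    (Nat.card {H : Submodule F M // u ≤ H ∧ finrank F H = finrank F u + 1} : ℂ)
      = qC (Fintype.card F) m := by
  have h1 := Submodule.finrank_quotient_add_finrank u
  rw [← gr_Q0 F (M ⧸ u) m (by omega)]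
  congr 1
  refine (Nat.card_congr ((Equiv.subtypeEquiv (Submodule.comapMkQRelIso u).toEquiv
    (q := fun H : Set.Ici u => finrank F (H.1 : Submodule F M) = finrank F u + 1) ?_).trans
    (Equiv.subtypeSubtypeEquivSubtypeInter _ (fun H : Submodule F M => finrank F H = finrank F u + 1)))).symm
  intro H
  have := gr_mkQ u H
  change _ ↔ finrank F (H.comap u.mkQ) = _
  omega

open Module in
theorem gr_Q2 (F : Type*) [Field F] [Fintype F] (M : Type*) [AddCommGroup M] [Module F M]
    [FiniteDimensional F M] (u : Submodule F M) (m : ℕ) (hm : finrank F M = finrank F u + m) :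
    (Nat.card {H : Submodule F M // u ≤ H ∧ finrank F H + 1 = finrank F M} : ℂ)
      = qC (Fintype.card F) m := by
  have h1 := Submodule.finrank_quotient_add_finrank u
  rw [← gr_Q1 F (M ⧸ u) m (by omega)]
  congr 1
  refine (Nat.card_congr ((Equiv.subtypeEquiv (Submodule.comapMkQRelIso u).toEquiv
    (q := fun H : Set.Ici u => finrank F (H.1 : Submodule F M) + 1 = finrank F M) ?_).trans
    (Equiv.subtypeSubtypeEquivSubtypeInter _ (fun H : Submodule F M => finrank F H + 1 = finrank F M)))).symm
  intro H
  have := gr_mkQ u H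
  change _ ↔ finrank F (H.comap u.mkQ) + 1 = _
  omega

open Module in
theorem gr_Q3 (F : Type*) [Field F] [Fintype F] (V : Type*) [AddCommGroup V] [Module F V]
    [FiniteDimensional F V] (u y : Submodule F V) (huy : u ≤ y) (m : ℕ)
    (hm : finrank F y = finrank F u + m) :
    (Nat.card {H : Submodule F V // H ≤ y ∧ (u ≤ H ∧ finrank F H + 1 = finrank F y)} : ℂ)
      = qC (Fintype.card F) m := by
  have hu : finrank F (u.comap y.subtype) = finrank F u :=
    (Submodule.comapSubtypeEquivOfLe huy).finrank_eq
  rw [← gr_Q2 F y (u.comap y.subtype) m (by omega)]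
  congr 1
  refine (Nat.card_congr ((Equiv.subtypeEquiv (Submodule.mapIic y).toEquiv
    (q := fun H : Set.Iic y => u ≤ H.1 ∧ finrank F H.1 + 1 = finrank F y) ?_).trans
    (Equiv.subtypeSubtypeEquivSubtypeInter _
      (fun H => u ≤ H ∧ finrank F H + 1 = finrank F y)))).symm
  intro H
  change _ ↔ u ≤ H.map y.subtype ∧ finrank F (H.map y.subtype) + 1 = _
  rw [Submodule.finrank_map_subtype_eq]
  refine and_congr_left fun _ => ⟨fun h => ?_, fun h v hv => ?_⟩
  · have h2 := Submodule.map_mono (f := y.subtype) h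
    rwa [Submodule.map_comap_subtype, inf_of_le_right huy] at h2
  · obtain ⟨w, hw, e⟩ := h hv
    rwa [← Subtype.ext e]

theorem gr_sum {X : Type*} [Finite X] (S : Set X) (p : X → Prop) :
    (∑ᶠ z ∈ S, (if p z then (1 : ℂ) else 0)) = (Nat.card {z : X // z ∈ S ∧ p z} : ℂ) := by
  have : Fintype X := Fintype.ofFinite X
  rw [finsum_mem_eq_finite_toFinset_sum _ (Set.toFinite S), Finset.sum_boole,
    Nat.card_eq_fintype_card, Fintype.card_subtype]
  congr 2
  ext z
  simp

theorem gr_sub {X : Type*} (P : X → Prop) (Q : X → Prop) :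
    Nat.card {z : {w : X // P w} // Q z.1} = Nat.card {z : X // P z ∧ Q z} :=
  Nat.card_congr (Equiv.subtypeSubtypeEquivSubtypeInter P Q)

open Module in
theorem gr_case1 (F : Type*) [Field F] [Fintype F] (V : Type*) [AddCommGroup V] [Module F V]
    [FiniteDimensional F V] (a y : Submodule F V) (hay : a ≤ y) (D : ℕ) (hD : 1 ≤ D)
    (hy : finrank F y = D) (m k : ℕ) (hm : D = finrank F a + m) (hk : finrank F V + 1 = D + k) :
    (Nat.card {z : Submodule F V // finrank F z = D ∧ (finrank F ↥(y ⊓ z) = D - 1 ∧ a ≤ z)} : ℂ)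
      = qC (Fintype.card F) m * (qC (Fintype.card F) k - 1) := by
  have : Finite V := Module.finite_of_finite F
  have : Fintype (Submodule F V) := Fintype.ofFinite _
  rw [← gr_Q3 F V a y hay m (by omega)]
  simp only [Nat.card_eq_fintype_card, Fintype.card_subtype]
  rw [Finset.card_eq_sum_card_fiberwise (f := fun z => y ⊓ z)
    (t := Finset.univ.filter fun H => H ≤ y ∧ (a ≤ H ∧ finrank F H + 1 = finrank F y))]
  · push_cast
    rw [Finset.sum_congr rfl (g := fun _ => qC (Fintype.card F) k - 1), Finset.sum_const,
      nsmul_eq_mul]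
    intro w hw
    simp only [Finset.mem_filter, Finset.mem_univ, true_and] at hw
    obtain ⟨hwy, haw, hwd⟩ := hw
    have h4 := gr_Q4 F V w k (by omega)
    rw [Nat.card_eq_fintype_card, Fintype.card_subtype] at h4
    rw [← h4]
    have hmem : y ∈ Finset.univ.filter
        fun H : Submodule F V => w ≤ H ∧ finrank F H = finrank F w + 1 := by
      simp [hwy, hwd]
    rw [← Finset.card_erase_add_one hmem]
    push_cast
    rw [add_sub_cancel_right]
    congr 2
    ext z
    simp only [Finset.mem_filter, Finset.mem_univ, true_and, Finset.mem_erase]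
    constructor
    · rintro ⟨⟨h1, h2, h3⟩, h5⟩
      refine ⟨?_, h5 ▸ inf_le_right, by omega⟩
      rintro rfl
      rw [inf_idem] at h2
      omega
    · rintro ⟨hne, hwz, hz⟩
      have hle : w ≤ y ⊓ z := le_inf hwy hwz
      have e : w = y ⊓ z := by
        apply Submodule.eq_of_le_of_finrank_le hle
        by_contra hc
        have e1 : y ⊓ z = y := Submodule.eq_of_le_of_finrank_le inf_le_left (by omega)
        have e2 : y ⊓ z = z := Submodule.eq_of_le_of_finrank_le inf_le_right (by omega)
        exact hne (e2.symm.trans e1)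
      refine ⟨⟨by omega, ?_, haw.trans hwz⟩, e.symm⟩
      rw [← e]; omega
  · intro z hz
    simp only [Finset.coe_filter, Finset.mem_univ, true_and, Set.mem_ofPred_eq] at hz ⊢
    exact ⟨inf_le_left, le_inf hay hz.2.2, by omega⟩

open Module in
theorem gr_case2 (F : Type*) [Field F] [Fintype F] (V : Type*) [AddCommGroup V] [Module F V]
    [FiniteDimensional F V] (a y : Submodule F V) (D : ℕ) (hD : 1 ≤ D)
    (hy : finrank F y = D) (m : ℕ) (h1 : finrank F ↥(a ⊓ y) + 1 = finrank F a)
    (hm : D + 1 = finrank F a + m) :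
    (Nat.card {z : Submodule F V // finrank F z = D ∧ (finrank F ↥(y ⊓ z) = D - 1 ∧ a ≤ z)} : ℂ)
      = qC (Fintype.card F) m := by
  rw [← gr_Q3 F V (a ⊓ y) y inf_le_right m (by omega)]
  congr 1
  have key : ∀ w : Submodule F V, w ≤ y → a ⊓ y ≤ w → finrank F w + 1 = finrank F y →
      finrank F ↥(w ⊔ a) = D ∧ y ⊓ (w ⊔ a) = w := by
    intro w hwy haw hw
    have e : w ⊓ a = a ⊓ y :=
      le_antisymm (le_inf inf_le_right (inf_le_left.trans hwy)) (le_inf haw inf_le_left)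
    have h2 := Submodule.finrank_sup_add_finrank_inf_eq w a
    rw [e] at h2
    refine ⟨by omega, ?_⟩
    rw [inf_comm, sup_inf_assoc_of_le a hwy, sup_eq_left.2 haw]
  refine Nat.card_congr
    { toFun := fun z => ⟨y ⊓ z.1, inf_le_left, ?_, ?_⟩
      invFun := fun w => ⟨w.1 ⊔ a, ?_, ?_, le_sup_right⟩
      left_inv := ?_
      right_inv := ?_ }
  · exact le_inf inf_le_right (inf_le_left.trans z.2.2.2)
  · have := z.2.2.1; omega
  · exact (key w.1 w.2.1 w.2.2.1 w.2.2.2).1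
  · rw [(key w.1 w.2.1 w.2.2.1 w.2.2.2).2]; have := w.2.2.2; omega
  · rintro ⟨z, hz, hyz, haz⟩
    apply Subtype.ext
    have k := (key (y ⊓ z) inf_le_left (le_inf inf_le_right (inf_le_left.trans haz))
      (by omega)).1
    exact Submodule.eq_of_le_of_finrank_le (sup_le inf_le_right haz) (hz.trans k.symm).le
  · rintro ⟨w, h1, h2, h3⟩
    exact Subtype.ext (key w h1 h2 h3).2

/-- Assume `N > 2D`, fix a vertex `x` of the Grassmann graph `J_q(N,D)`, and let `α ⊆ x` with
`dim α = i`. Then `A α^∨ = θ_i α^∨ + [D-i+1] Σ_β β^∨`, where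
`θ_i = q[D][N-D] - [i][N-i+1]`, the adjacency operator acts by
`(A f)(y) = Σ_{z adjacent to y} f(z)`, and the sum is over all subspaces `β ⊆ α` with
`dim β = i - 1` (i.e. `α` covers `β`). -/
theorem stmt12 (q : ℕ) (F : Type*) [Field F] [Fintype F] (hF : Fintype.card F = q)
    (N D : ℕ) (hD : 1 ≤ D) (hND : 2 * D < N)
    (V : Type*) [AddCommGroup V] [Module F V] [FiniteDimensional F V]
    (hV : Module.finrank F V = N)
    (x : Submodule F V) (hx : Module.finrank F ↥x = D)
    (α : Submodule F V) (hαx : α ≤ x) (i : ℕ) (hi : Module.finrank F ↥α = i) :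
    ∀ y : {W : Submodule F V // Module.finrank F ↥W = D},
      (∑ᶠ z ∈ {z : {W : Submodule F V // Module.finrank F ↥W = D} |
            Module.finrank F ↥(y.1 ⊓ z.1) = D - 1},
          (if α ≤ z.1 then (1 : ℂ) else 0))
        = ((q : ℂ) * qC q D * qC q ((N : ℤ) - D) - qC q i * qC q ((N : ℤ) - i + 1)) *
            (if α ≤ y.1 then (1 : ℂ) else 0)
          + qC q ((D : ℤ) - i + 1) *
            ∑ᶠ β ∈ {β : Submodule F V | β ≤ α ∧ Module.finrank F ↥β + 1 = i},
              (if β ≤ y.1 then (1 : ℂ) else 0) := by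
  intro y
  obtain ⟨y, hy⟩ := y
  have : Finite V := Module.finite_of_finite F
  have : Finite (Submodule F V) := inferInstance
  rw [gr_sum, gr_sum]
  have hl : Nat.card {z : {W : Submodule F V // Module.finrank F ↥W = D} //
      z ∈ {z : {W : Submodule F V // Module.finrank F ↥W = D} |
            Module.finrank F ↥(y ⊓ z.1) = D - 1} ∧ α ≤ z.1} =
      Nat.card {z : Submodule F V // Module.finrank F z = D ∧
        (Module.finrank F ↥(y ⊓ z) = D - 1 ∧ α ≤ z)} :=
    gr_sub (fun W : Submodule F V => Module.finrank F ↥W = D)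
      (fun z => Module.finrank F ↥(y ⊓ z) = D - 1 ∧ α ≤ z)
  rw [hl]
  have hiD : i ≤ D := by rw [← hi, ← hx]; exact Submodule.finrank_mono hαx
  have hq : 1 < q := hF ▸ Fintype.one_lt_card
  have hq0 : (q : ℂ) ≠ 0 := by exact_mod_cast (by omega : q ≠ 0)
  have hq1 : (q : ℂ) - 1 ≠ 0 := sub_ne_zero.2 (by exact_mod_cast hq.ne')
  by_cases hay : α ≤ y
  · rw [gr_case1 F V α y hay D hD hy (D - i) (N + 1 - D) (by omega) (by omega)]
    have hr : (Nat.card {z : Submodule F V //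
        z ∈ {β : Submodule F V | β ≤ α ∧ Module.finrank F ↥β + 1 = i} ∧ z ≤ y} : ℂ)
        = qC q i := by
      rw [← hF, ← gr_Q3 F V ⊥ α bot_le i (by rw [finrank_bot]; omega)]
      congr 1
      refine Nat.card_congr (Equiv.subtypeEquivRight fun z => ?_)
      simp only [Set.mem_ofPred_eq, bot_le, true_and, hi]
      exact ⟨fun h => h.1, fun h => ⟨h, h.1.trans hay⟩⟩
    rw [hr, hF, if_pos hay]
    obtain ⟨m, rfl⟩ := Nat.exists_eq_add_of_le hiD
    obtain ⟨k, rfl⟩ := Nat.exists_eq_add_of_le (show i + m ≤ N by omega)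
    rw [show i + m - i = m by omega, show i + m + k + 1 - (i + m) = k + 1 by omega,
      show ((i + m + k : ℕ) : ℤ) - (i + m : ℕ) = (k : ℕ) by push_cast; ring,
      show ((i + m + k : ℕ) : ℤ) - i + 1 = (m + k + 1 : ℕ) by push_cast; ring,
      show ((i + m : ℕ) : ℤ) - i + 1 = (m + 1 : ℕ) by push_cast; ring]
    simp only [qC, zpow_natCast]
    field_simp
    ring
  · rw [if_neg hay, mul_zero, zero_add]
    have hle : Module.finrank F ↥(α ⊓ y) < i := by
      rw [← hi]
      exact Submodule.finrank_lt_finrank_of_lt (inf_lt_left.2 hay)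
    by_cases h1 : Module.finrank F ↥(α ⊓ y) + 1 = i
    · rw [gr_case2 F V α y D hD hy (D + 1 - i) (by omega) (by omega), hF]
      have hr : Nat.card {z : Submodule F V //
          z ∈ {β : Submodule F V | β ≤ α ∧ Module.finrank F ↥β + 1 = i} ∧ z ≤ y} = 1 := by
        rw [Nat.card_eq_one_iff_unique]
        refine ⟨⟨?_⟩, ⟨⟨α ⊓ y, ⟨inf_le_left, h1⟩, inf_le_right⟩⟩⟩
        have hu : ∀ z : Submodule F V, z ≤ α → Module.finrank F z + 1 = i → z ≤ y →
            z = α ⊓ y := fun z h2 h3 h4 =>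
          Submodule.eq_of_le_of_finrank_le (le_inf h2 h4) (by omega)
        rintro ⟨z, ⟨h2, h3⟩, h4⟩ ⟨z', ⟨h2', h3'⟩, h4'⟩
        exact Subtype.ext ((hu z h2 h3 h4).trans (hu z' h2' h3' h4').symm)
      rw [hr, show (D : ℤ) - i + 1 = (D + 1 - i : ℕ) by omega]
      simp
    · have e1 : IsEmpty {z : Submodule F V // Module.finrank F z = D ∧
          (Module.finrank F ↥(y ⊓ z) = D - 1 ∧ α ≤ z)} := by
        refine ⟨?_⟩
        rintro ⟨z, hz, hyz, haz⟩
        have h2 := Submodule.finrank_sup_add_finrank_inf_eq α (y ⊓ z)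
        have h3 : Module.finrank F ↥(α ⊔ y ⊓ z) ≤ Module.finrank F z :=
          Submodule.finrank_mono (sup_le haz inf_le_right)
        have h4 : α ⊓ (y ⊓ z) = α ⊓ y := by
          rw [inf_comm y z, ← inf_assoc, inf_eq_left.2 haz]
        rw [h4] at h2
        omega
      have e2 : IsEmpty {z : Submodule F V //
          z ∈ {β : Submodule F V | β ≤ α ∧ Module.finrank F ↥β + 1 = i} ∧ z ≤ y} := by
        refine ⟨?_⟩
        rintro ⟨z, ⟨h2, h3⟩, h4⟩
        have := Submodule.finrank_mono (le_inf h2 h4)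
        omega
      simp only [Nat.card_of_isEmpty, Nat.cast_zero, mul_zero]
end

section
/- Assume N > 2D, fix a vertex x ∈ X, and let α ⊆ x be a subspace with dim α = i. Then A α^N = [D−i](q[N−D]−[D−i]) α^N + q^{2D−2i−1}[N−2D+i+1] Σ_{β ⊆ x, dim β = i+1, α ⊆ β} β^N + q^{D−i} Σ_{β ⊆ x, dim β = i, dim(α ∩ β) = i−1} β^N + [D−i+1] Σ_{β ⊆ α, dim β = i−1} β^N. -/
open scoped Classical

set_option linter.unusedSectionVars false

lemma ncard_fib {A B : Type*} [Finite A] [Finite B] (S : Set A) (T : Set B) (f : A → B) (c : ℕ)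
    (h1 : ∀ a ∈ S, f a ∈ T) (h2 : ∀ b ∈ T, {a | a ∈ S ∧ f a = b}.ncard = c) :
    S.ncard = T.ncard * c := by
  have := Fintype.ofFinite A
  have := Fintype.ofFinite B
  rw [Set.ncard_eq_toFinset_card', Set.ncard_eq_toFinset_card',
    Finset.card_eq_sum_card_fiberwise (f := f) (t := T.toFinset)
      (by intro a ha; simpa using h1 a (by simpa using ha))]
  rw [Finset.sum_const_nat (m := c)]
  intro b hb
  rw [← h2 b (by simpa using hb), Set.ncard_eq_toFinset_card']
  congr 1
  ext a
  simp

section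
variable {F : Type*} [Field F] [Fintype F] {V : Type*} [AddCommGroup V] [Module F V]
  [FiniteDimensional F V]

lemma finV (F : Type*) [Field F] [Fintype F] (V : Type*) [AddCommGroup V] [Module F V]
  [FiniteDimensional F V] : Finite V := Module.finite_of_finite F

lemma ncard_sub (W : Submodule F V) :
    (W : Set V).ncard = Fintype.card F ^ Module.finrank F W := by
  rw [← Nat.card_coe_set_eq]
  have := Module.natCard_eq_pow_finrank (K := F) (V := W)
  rw [Nat.card_eq_fintype_card (α := F)] at this
  exact this

lemma ncard_sdiff {H W : Submodule F V} (h : H ≤ W) :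
    ((W : Set V) \ H).ncard + Fintype.card F ^ Module.finrank F H
      = Fintype.card F ^ Module.finrank F W := by
  have := finV F V
  rw [← ncard_sub, ← ncard_sub]
  exact Set.ncard_sdiff_add_ncard_of_subset h

def PP (H W : Submodule F V) : Set (Submodule F V) :=
  {z | H ≤ z ∧ z ≤ W ∧ Module.finrank F z = Module.finrank F H + 1}

def QQ (g y : Submodule F V) : Set (Submodule F V) :=
  {z | g ≤ z ∧ z ≤ y ∧ Module.finrank F z + 1 = Module.finrank F y}

lemma rank_sup_span {H : Submodule F V} {v : V} (hv : v ∉ H) :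
    Module.finrank F ↥(H ⊔ F ∙ v) = Module.finrank F H + 1 := by
  have h0 : v ≠ 0 := by rintro rfl; exact hv H.zero_mem
  have h1 := Submodule.finrank_sup_add_finrank_inf_eq H (F ∙ v)
  have h2 : H ⊓ (F ∙ v) = ⊥ := by
    rw [← disjoint_iff, Submodule.disjoint_span_singleton' h0]; exact hv
  rw [h2, finrank_span_singleton h0, finrank_bot] at h1
  omega

lemma qC_ne {q : ℕ} (hq : 1 < q) : (q : ℂ) - 1 ≠ 0 := by
  rw [sub_ne_zero]; exact_mod_cast hq.ne'

lemma card_PP {H W : Submodule F V} (h : H ≤ W) (k : ℕ)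
    (hk : Module.finrank F W = Module.finrank F H + k) :
    ((PP H W).ncard : ℂ) = qC (Fintype.card F) k := by
  have := finV F V
  have hq : 1 < Fintype.card F := Fintype.one_lt_card
  set q := Fintype.card F
  set n := Module.finrank F H
  have key := ncard_fib ((W : Set V) \ H) (PP H W) (fun v => H ⊔ F ∙ v) (q ^ (n+1) - q ^ n)
    (by
      rintro v ⟨hv, hv'⟩
      refine ⟨le_sup_left, sup_le h ?_, rank_sup_span hv'⟩
      simpa using hv)
    (by
      rintro z ⟨hz1, hz2, hz3⟩
      have := ncard_sdiff hz1
      rw [hz3] at this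
      rw [eq_tsub_iff_add_eq_of_le (Nat.pow_le_pow_right (by omega) (by omega)), ← this]
      congr 2
      ext v
      constructor
      · rintro ⟨⟨_, h2⟩, rfl⟩
        exact ⟨Submodule.mem_sup_right (Submodule.mem_span_singleton_self v), h2⟩
      · rintro ⟨h1, h2⟩
        refine ⟨⟨hz2 h1, h2⟩, ?_⟩
        apply Submodule.eq_of_le_of_finrank_eq
        · apply sup_le hz1; simpa using h1
        · rw [rank_sup_span h2, hz3])
  have h3 := ncard_sdiff h
  rw [key, hk] at h3
  have h4 : q ^ n ≤ q ^ (n+1) := Nat.pow_le_pow_right (by omega) (by omega)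
  have h5 := congrArg (Nat.cast (R := ℂ)) h3
  push_cast [Nat.cast_sub h4] at h5
  have hq0 : (q : ℂ) ≠ 0 := by exact_mod_cast (by omega : q ≠ 0)
  rw [qC, eq_div_iff (qC_ne hq), zpow_natCast]
  apply mul_left_cancel₀ (pow_ne_zero n hq0)
  rw [pow_add] at h5
  linear_combination h5

lemma card_QQ {g y : Submodule F V} (h : g ≤ y) (k : ℕ)
    (hk : Module.finrank F y = Module.finrank F g + k) :
    ((QQ g y).ncard : ℂ) = qC (Fintype.card F) k := by
  have e := fun W : Submodule F V => Subspace.finrank_add_finrank_dualAnnihilator_eq W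
  have ey := e y
  have eg := e g
  rw [← card_PP (F := F) (V := Module.Dual F V) (H := y.dualAnnihilator) (W := g.dualAnnihilator)
    (Submodule.dualAnnihilator_anti h) k (by omega)]
  congr 1
  refine Set.ncard_congr (fun z _ => z.dualAnnihilator) ?_ ?_ ?_
  · rintro z ⟨h1, h2, h3⟩
    refine ⟨Submodule.dualAnnihilator_anti h2, Submodule.dualAnnihilator_anti h1, ?_⟩
    have := e z
    omega
  · intro a b _ _ hab
    exact Subspace.dualAnnihilator_inj.1 hab
  · rintro z ⟨h1, h2, h3⟩
    have hz : z.dualCoannihilator.dualAnnihilator = z :=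
      Subspace.dualCoannihilator_dualAnnihilator_eq
    refine ⟨z.dualCoannihilator, ⟨?_, ?_, ?_⟩, hz⟩
    · rw [← Subspace.dualAnnihilator_le_dualAnnihilator_iff, hz]; exact h2
    · rw [← Subspace.dualAnnihilator_le_dualAnnihilator_iff, hz]; exact h1
    · have := e z.dualCoannihilator
      rw [hz] at this
      omega

def SS (x α y : Submodule F V) : Set (Submodule F V) :=
  {z | Module.finrank F z = Module.finrank F y ∧
    Module.finrank F ↥(y ⊓ z) + 1 = Module.finrank F y ∧ z ⊓ x = α}

lemma inf_iff {H x z : Submodule F V} (hz : z ∈ PP H ⊤) :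
    z ⊓ x = H ⊓ x ↔ ¬ z ≤ H ⊔ x := by
  obtain ⟨h1, -, h3⟩ := hz
  constructor
  · intro h hle
    have : z ≤ H := by
      calc z = (H ⊔ x) ⊓ z := (inf_eq_right.2 hle).symm
        _ = H ⊔ x ⊓ z := (sup_inf_assoc_of_le x h1)
        _ ≤ H := sup_le le_rfl (by rw [inf_comm, h]; exact inf_le_left)
    have := Submodule.finrank_mono this
    omega
  · intro h
    by_contra hne
    apply h
    have h4 : ¬ z ⊓ x ≤ H := fun h5 =>
      hne (le_antisymm (le_inf h5 inf_le_right) (inf_le_inf_right x h1))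
    have h6 : H < H ⊔ z ⊓ x := by simpa using h4
    have h7 : H ⊔ z ⊓ x = z := by
      apply Submodule.eq_of_le_of_finrank_le (sup_le h1 inf_le_left)
      have := Submodule.finrank_lt_finrank_of_lt h6
      omega
    rw [← h7]
    exact sup_le_sup_left inf_le_right H

lemma card_fib {H x : Submodule F V} (k l : ℕ)
    (hk : Module.finrank F V = Module.finrank F H + k)
    (hl : Module.finrank F ↥(H ⊔ x) = Module.finrank F H + l) :
    (({z | z ∈ PP H ⊤ ∧ z ⊓ x = H ⊓ x} : Set (Submodule F V)).ncard : ℂ)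
      = qC (Fintype.card F) k - qC (Fintype.card F) l := by
  have := finV F V
  have h1 := card_PP (F := F) (V := V) (H := H) (W := ⊤) le_top k (by rw [finrank_top]; exact hk)
  have h2 := card_PP (F := F) (V := V) (H := H) (W := H ⊔ x) le_sup_left l hl
  rw [← h1, ← h2, eq_sub_iff_add_eq]
  norm_cast
  have hs : PP H (H ⊔ x) ⊆ PP H ⊤ := fun z hz => ⟨hz.1, le_top, hz.2.2⟩
  rw [← Set.ncard_sdiff_add_ncard_of_subset hs]
  congr 2
  ext z
  constructor
  · rintro ⟨h, h'⟩
    exact ⟨h, fun h3 => (inf_iff h).1 h' h3.2.1⟩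
  · rintro ⟨h, h'⟩
    exact ⟨h, (inf_iff h).2 fun h3 => h' ⟨h.1, h3, h.2.2⟩⟩

lemma mem_fib {x α y H : Submodule F V} (hH : H ≤ y) (hr : Module.finrank F H + 1 = Module.finrank F y)
    (hα : H ⊓ x = α) (z : Submodule F V) :
    (z ∈ SS x α y ∧ y ⊓ z = H) ↔ (z ∈ PP H ⊤ ∧ z ⊓ x = H ⊓ x) ∧ z ≠ y := by
  constructor
  · rintro ⟨⟨h1, h2, h3⟩, rfl⟩
    refine ⟨⟨⟨inf_le_right, le_top, by omega⟩, by rw [h3, hα]⟩, ?_⟩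
    rintro rfl
    rw [inf_idem] at h2
    omega
  · rintro ⟨⟨⟨h1, _, h2⟩, h3⟩, h4⟩
    have : y ⊓ z = H := by
      by_contra hne
      have hlt : H < y ⊓ z := lt_of_le_of_ne (le_inf hH h1) (Ne.symm hne)
      have h5 := Submodule.finrank_lt_finrank_of_lt hlt
      have h6 : y ⊓ z = y := Submodule.eq_of_le_of_finrank_le inf_le_left (by omega)
      have h7 : y ⊓ z = z := Submodule.eq_of_le_of_finrank_le inf_le_right (by omega)
      exact h4 (h7.symm.trans h6)
    exact ⟨⟨by omega, by rw [this]; exact hr, by rw [h3, hα]⟩, this⟩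

/-- case 1 -/
lemma case1 {x y : Submodule F V} (k m : ℕ) (hxy : Module.finrank F x = Module.finrank F y)
    (hk : Module.finrank F y = Module.finrank F ↥(y ⊓ x) + k)
    (hm : Module.finrank F V = Module.finrank F y + m) :
    ((SS x (y ⊓ x) y).ncard : ℂ) = qC (Fintype.card F) k *
      (qC (Fintype.card F) (m + 1 : ℕ) - qC (Fintype.card F) k - 1) := by
  have := finV F V
  have hQ := card_QQ (inf_le_left : y ⊓ x ≤ y) k hk
  by_cases hne : (QQ (y ⊓ x) y).Nonempty
  · have hf : ∀ H ∈ QQ (y ⊓ x) y, (({z | z ∈ SS x (y ⊓ x) y ∧ y ⊓ z = H}).ncard : ℂ) =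
        (qC (Fintype.card F) (m + 1 : ℕ) - qC (Fintype.card F) k - 1) := by
      rintro H ⟨h1, h2, h3⟩
      have hα : H ⊓ x = y ⊓ x :=
        le_antisymm (inf_le_inf_right x h2) (le_inf h1 inf_le_right)
      have h5 := Submodule.finrank_sup_add_finrank_inf_eq H x
      rw [hα] at h5
      rw [← card_fib (H := H) (x := x) (m+1) k (by omega) (by omega)]
      rw [eq_sub_iff_add_eq]
      norm_cast
      have hy : y ∈ {z | z ∈ PP H ⊤ ∧ z ⊓ x = H ⊓ x} := ⟨⟨h2, le_top, h3.symm⟩, hα.symm⟩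
      rw [← Set.ncard_sdiff_singleton_add_one hy]
      congr 2
      ext z
      rw [Set.mem_ofPred, mem_fib h2 h3 hα]
      rfl
    obtain ⟨H0, hH0⟩ := hne
    rw [← hf H0 hH0, ← hQ]
    norm_cast
    apply ncard_fib _ _ (fun z => y ⊓ z)
    · rintro z ⟨h1, h2, h3⟩
      exact ⟨le_inf inf_le_left (h3 ▸ inf_le_left), inf_le_left, h2⟩
    · intro H hH
      have := (hf H hH).trans (hf H0 hH0).symm
      exact_mod_cast this
  · rw [Set.not_nonempty_iff_eq_empty] at hne
    have : SS x (y ⊓ x) y = ∅ := by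
      rw [Set.eq_empty_iff_forall_notMem] at hne ⊢
      rintro z ⟨h1, h2, h3⟩
      exact hne (y ⊓ z) ⟨le_inf inf_le_left (h3 ▸ inf_le_left), inf_le_left, h2⟩
    rw [this, ← hQ, hne]; simp

lemma card_QQ_diff {g d y : Submodule F V} (hdg : d ≤ g) (h : g ≤ y) (k : ℕ)
    (hk : Module.finrank F y = Module.finrank F g + k)
    (hg : Module.finrank F g = Module.finrank F d + 1) :
    ((QQ d y \ QQ g y).ncard : ℂ) = (Fintype.card F : ℂ) ^ k := by
  have := finV F V
  have hs : QQ g y ⊆ QQ d y := fun z hz => ⟨hdg.trans hz.1, hz.2⟩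
  have h1 := card_QQ h k hk
  have h2 := card_QQ (hdg.trans h) (k+1) (by omega)
  rw [← Set.ncard_sdiff_add_ncard_of_subset hs] at h2
  push_cast at h2
  rw [h1] at h2
  rw [eq_sub_of_add_eq h2]
  have hq := qC_ne (Fintype.one_lt_card (α := F))
  have h3 : ((k:ℤ) + 1) = ((k+1 : ℕ) : ℤ) := by push_cast; rfl
  rw [qC, qC, h3, zpow_natCast, zpow_natCast]
  field_simp
  ring

lemma QQ_diff_inf {g d y H : Submodule F V} (hdg : d ≤ g)
    (hg : Module.finrank F g = Module.finrank F d + 1) (hH : H ∈ QQ d y \ QQ g y) :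
    H ⊓ g = d := by
  obtain ⟨⟨h1, h2, h3⟩, h4⟩ := hH
  symm
  apply Submodule.eq_of_le_of_finrank_le (le_inf h1 hdg)
  have : H ⊓ g < g := lt_of_le_of_ne inf_le_right fun h5 =>
    h4 ⟨inf_eq_right.1 h5, h2, h3⟩
  have := Submodule.finrank_lt_finrank_of_lt this
  omega

/-- case 2 -/
lemma case2 {x α y : Submodule F V} (k m : ℕ) (hxy : Module.finrank F x = Module.finrank F y)
    (hα : α ≤ y ⊓ x) (hg : Module.finrank F ↥(y ⊓ x) = Module.finrank F α + 1)
    (hk : Module.finrank F y = Module.finrank F ↥(y ⊓ x) + k)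
    (hm : Module.finrank F V = Module.finrank F y + m) :
    ((SS x α y).ncard : ℂ) = (Fintype.card F : ℂ) ^ k *
      (qC (Fintype.card F) (m + 1 : ℕ) - qC (Fintype.card F) (k + 1 : ℕ)) := by
  have := finV F V
  have hc := card_QQ_diff hα inf_le_left k hk hg
  rw [← hc]
  have hf : ∀ H ∈ QQ α y \ QQ (y ⊓ x) y, (({z | z ∈ SS x α y ∧ y ⊓ z = H}).ncard : ℂ) =
        (qC (Fintype.card F) (m + 1 : ℕ) - qC (Fintype.card F) (k + 1 : ℕ)) := by
    intro H hH
    have hi := QQ_diff_inf hα hg hH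
    obtain ⟨⟨h1, h2, h3⟩, h4⟩ := hH
    have hα' : H ⊓ x = α := by
      rw [← hi, ← inf_assoc, inf_eq_left.2 h2]
    have h5 := Submodule.finrank_sup_add_finrank_inf_eq H x
    rw [hα'] at h5
    rw [← card_fib (H := H) (x := x) (m+1) (k+1) (by omega) (by omega)]
    congr 2
    ext z
    rw [Set.mem_ofPred, mem_fib h2 h3 hα']
    refine ⟨fun h => h.1, fun h => ⟨h, ?_⟩⟩
    rintro rfl
    have := h.2
    rw [hα'] at this
    rw [this] at hg
    omega
  have hne : (QQ α y \ QQ (y ⊓ x) y).Nonempty := by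
    rw [← Set.ncard_pos]
    have : (0:ℕ) ≠ (QQ α y \ QQ (y ⊓ x) y).ncard := by
      intro h0
      rw [← h0] at hc
      have : (Fintype.card F : ℂ) ≠ 0 := by exact_mod_cast Fintype.card_ne_zero
      exact pow_ne_zero k this (by simpa using hc.symm)
    omega
  obtain ⟨H0, hH0⟩ := hne
  rw [← hf H0 hH0]
  norm_cast
  apply ncard_fib _ _ (fun z => y ⊓ z)
  · rintro z ⟨h1, h2, h3⟩
    refine ⟨⟨le_inf (hα.trans inf_le_left) (h3 ▸ inf_le_left), inf_le_left, h2⟩, ?_⟩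
    rintro ⟨h4, -⟩
    have h5 : y ⊓ x ≤ α := by
      rw [← h3]; exact le_inf (h4.trans inf_le_right) inf_le_right
    have := Submodule.finrank_mono h5
    omega
  · intro H hH
    have := (hf H hH).trans (hf H0 hH0).symm
    exact_mod_cast this

/-- cases 3 and 4 -/
lemma case34 {x α y : Submodule F V} (hαx : α ≤ x)
    (hg : Module.finrank F α = Module.finrank F ↥(y ⊓ x ⊓ α) + 1)
    (T : Set (Submodule F V))
    (hT : ∀ H, H ∈ T ↔ H ≤ y ∧ Module.finrank F H + 1 = Module.finrank F y ∧
      H ⊓ x = y ⊓ x ⊓ α) :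
    (SS x α y).ncard = T.ncard := by
  have := finV F V
  rw [ncard_fib (SS x α y) T (fun z => y ⊓ z) 1, mul_one]
  · rintro z ⟨h1, h2, h3⟩
    rw [hT]
    refine ⟨inf_le_left, h2, ?_⟩
    rw [← h3]
    apply le_antisymm
    · exact le_inf (inf_le_inf_right x inf_le_left) (inf_le_inf_right x inf_le_right)
    · exact le_inf (le_inf (inf_le_left.trans inf_le_left) (inf_le_right.trans inf_le_left))
        (inf_le_left.trans inf_le_right)
  · intro H hH
    obtain ⟨h1, h2, h3⟩ := (hT H).1 hH
    rw [Set.ncard_eq_one]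
    have hHα : H ⊓ α = y ⊓ x ⊓ α := by
      apply le_antisymm
      · exact le_inf (le_inf (inf_le_left.trans h1) (inf_le_right.trans hαx)) inf_le_right
      · exact le_inf (h3 ▸ inf_le_left) inf_le_right
    have h5 := Submodule.finrank_sup_add_finrank_inf_eq H α
    rw [hHα] at h5
    refine ⟨H ⊔ α, ?_⟩
    ext z
    simp only [Set.mem_ofPred, Set.mem_singleton_iff]
    constructor
    · rintro ⟨⟨e1, e2, e3⟩, rfl⟩
      symm
      apply Submodule.eq_of_le_of_finrank_le
      · exact sup_le inf_le_right (e3 ▸ inf_le_left)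
      · omega
    · rintro rfl
      have hyz : y ⊓ (H ⊔ α) = H := by
        rw [inf_comm, sup_inf_assoc_of_le α h1, sup_eq_left]
        have : α ⊓ y ≤ y ⊓ x ⊓ α :=
          le_inf (le_inf inf_le_right (inf_le_left.trans hαx)) inf_le_left
        exact this.trans (h3 ▸ inf_le_left)
      refine ⟨⟨by omega, by rw [hyz]; exact h2, ?_⟩, hyz⟩
      rw [sup_comm, sup_inf_assoc_of_le H hαx, sup_eq_left, h3]
      exact inf_le_right

lemma case3 {x α y : Submodule F V} (hαx : α ≤ x) (k : ℕ)
    (hg : Module.finrank F α = Module.finrank F ↥(y ⊓ x ⊓ α) + 1)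
    (hg' : Module.finrank F ↥(y ⊓ x) = Module.finrank F ↥(y ⊓ x ⊓ α) + 1)
    (hk : Module.finrank F y = Module.finrank F ↥(y ⊓ x) + k) :
    ((SS x α y).ncard : ℂ) = (Fintype.card F : ℂ) ^ k := by
  rw [case34 hαx hg (QQ (y ⊓ x ⊓ α) y \ QQ (y ⊓ x) y),
    card_QQ_diff inf_le_left inf_le_left k hk hg']
  intro H
  constructor
  · intro hH
    have hi := QQ_diff_inf inf_le_left hg' hH
    obtain ⟨⟨h1, h2, h3⟩, h4⟩ := hH
    refine ⟨h2, h3, ?_⟩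
    rw [← hi, ← inf_assoc, inf_eq_left.2 h2]
  · rintro ⟨h1, h2, h3⟩
    refine ⟨⟨h3 ▸ inf_le_left, h1, h2⟩, ?_⟩
    rintro ⟨h4, -⟩
    have : y ⊓ x ≤ y ⊓ x ⊓ α := h3 ▸ le_inf h4 inf_le_right
    have := Submodule.finrank_mono this
    omega

lemma case4 {x α y : Submodule F V} (hαx : α ≤ x) (k : ℕ) (hle : y ⊓ x ≤ α)
    (hg : Module.finrank F α = Module.finrank F ↥(y ⊓ x) + 1)
    (hk : Module.finrank F y = Module.finrank F ↥(y ⊓ x) + k) :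
    ((SS x α y).ncard : ℂ) = qC (Fintype.card F) k := by
  have hi : y ⊓ x ⊓ α = y ⊓ x := inf_eq_left.2 hle
  rw [case34 hαx (by rw [hi]; exact hg) (QQ (y ⊓ x) y), card_QQ inf_le_left k hk]
  intro H
  rw [hi]
  constructor
  · rintro ⟨h1, h2, h3⟩
    exact ⟨h2, h3, le_antisymm (inf_le_inf_right x h2) (le_inf h1 inf_le_right)⟩
  · rintro ⟨h1, h2, h3⟩
    exact ⟨h3 ▸ inf_le_left, h1, h2⟩

lemma codim {H y g : Submodule F V} (hH : H ≤ y) (hg : g ≤ y)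
    (h : Module.finrank F H + 1 = Module.finrank F y) :
    Module.finrank F g ≤ Module.finrank F ↥(H ⊓ g) + 1 := by
  have h1 := Submodule.finrank_sup_add_finrank_inf_eq H g
  have h2 := Submodule.finrank_mono (sup_le hH hg)
  omega

lemma nonzero {x α y z : Submodule F V} (hz : z ∈ SS x α y) :
    Module.finrank F ↥(y ⊓ x) ≤ Module.finrank F ↥(y ⊓ x ⊓ α) + 1 ∧
    Module.finrank F α ≤ Module.finrank F ↥(y ⊓ x ⊓ α) + 1 := by
  obtain ⟨h1, h2, h3⟩ := hz
  constructor
  · have := codim (g := y ⊓ x) (inf_le_left : y ⊓ z ≤ y) inf_le_left h2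
    have e : y ⊓ z ⊓ (y ⊓ x) = y ⊓ x ⊓ α := by
      rw [← h3]; ac_nf
    rwa [e] at this
  · have := codim (g := z ⊓ x) (inf_le_right : y ⊓ z ≤ z) inf_le_left (h2.trans h1.symm)
    have e : y ⊓ z ⊓ (z ⊓ x) = y ⊓ x ⊓ α := by
      rw [← h3]; ac_nf
    rwa [e, h3] at this
end

lemma finsum_ind {A : Type*} (S : Set A) (g : A) [∀ β, Decidable (g = β)] :
    (∑ᶠ β ∈ S, (if g = β then (1 : ℂ) else 0)) = if g ∈ S then 1 else 0 := by
  rw [finsum_eq_single _ g]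
  · by_cases h : g ∈ S <;> simp [h]
  · intro b hb
    simp [Ne.symm hb]

lemma finsum_cnt {A : Type*} [Finite A] (S : Set A) (p : A → Prop) [∀ a, Decidable (p a)] :
    (∑ᶠ a ∈ S, (if p a then (1 : ℂ) else 0)) = (({a | a ∈ S ∧ p a} : Set A).ncard : ℂ) := by
  have := Fintype.ofFinite A
  rw [finsum_eq_sum_of_fintype, Set.ncard_eq_toFinset_card', Finset.card_eq_sum_ones,
    Nat.cast_sum, Set.toFinset_ofPred, Finset.sum_filter]
  apply Finset.sum_congr rfl
  intro a _
  by_cases h : a ∈ S <;> by_cases h' : p a <;> simp [h, h']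

lemma finsum_SS {F : Type*} [Field F] [Fintype F] {V : Type*} [AddCommGroup V] [Module F V]
    [FiniteDimensional F V] (x α : Submodule F V) (D : ℕ) (hD : 1 ≤ D)
    (y : {W : Submodule F V // Module.finrank F ↥W = D}) :
    (∑ᶠ z ∈ {z : {W : Submodule F V // Module.finrank F ↥W = D} |
            Module.finrank F ↥(y.1 ⊓ z.1) = D - 1},
          (if z.1 ⊓ x = α then (1 : ℂ) else 0)) = ((SS x α y.1).ncard : ℂ) := by
  have := finV F V
  have e : SS x α y.1 = Subtype.val '' {z : {W : Submodule F V // Module.finrank F ↥W = D} |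
      Module.finrank F ↥(y.1 ⊓ z.1) = D - 1 ∧ z.1 ⊓ x = α} := by
    have hy := y.2
    ext z
    constructor
    · rintro ⟨h1, h2, h3⟩
      refine ⟨⟨z, h1.trans hy⟩, ⟨?_, h3⟩, rfl⟩
      show Module.finrank F ↥(y.1 ⊓ z) = D - 1
      omega
    · rintro ⟨z, ⟨h1, h2⟩, rfl⟩
      exact ⟨z.2.trans hy.symm, by omega, h2⟩
  rw [e, Set.ncard_image_of_injective _ Subtype.val_injective]
  exact finsum_cnt _ _


/-- Assume `N > 2D`, fix a vertex `x` of the Grassmann graph `J_q(N,D)`, and let `α ⊆ x` with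
`dim α = i`. Then
`A α^N = [D-i](q[N-D]-[D-i]) α^N + q^{2D-2i-1}[N-2D+i+1] Σ_{β ⊆ x, dim β = i+1, α ⊆ β} β^N`
`+ q^{D-i} Σ_{β ⊆ x, dim β = i, dim(α ∩ β) = i-1} β^N + [D-i+1] Σ_{β ⊆ α, dim β = i-1} β^N`,
where `(A f)(y) = Σ_{z adjacent to y} f(z)` and `β^N` is the characteristic vector of
`G_β = {y : y ∩ x = β}`. -/
theorem stmt13 (q : ℕ) (F : Type*) [Field F] [Fintype F] (hF : Fintype.card F = q)
    (N D : ℕ) (hD : 1 ≤ D) (hND : 2 * D < N)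
    (V : Type*) [AddCommGroup V] [Module F V] [FiniteDimensional F V]
    (hV : Module.finrank F V = N)
    (x : Submodule F V) (hx : Module.finrank F ↥x = D)
    (α : Submodule F V) (hαx : α ≤ x) (i : ℕ) (hi : Module.finrank F ↥α = i) :
    ∀ y : {W : Submodule F V // Module.finrank F ↥W = D},
      (∑ᶠ z ∈ {z : {W : Submodule F V // Module.finrank F ↥W = D} |
            Module.finrank F ↥(y.1 ⊓ z.1) = D - 1},
          (if z.1 ⊓ x = α then (1 : ℂ) else 0))
        = qC q ((D : ℤ) - i) * ((q : ℂ) * qC q ((N : ℤ) - D) - qC q ((D : ℤ) - i)) *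
            (if y.1 ⊓ x = α then (1 : ℂ) else 0)
          + (q : ℂ) ^ (2 * (D : ℤ) - 2 * i - 1) * qC q ((N : ℤ) - 2 * D + i + 1) *
            (∑ᶠ β ∈ {β : Submodule F V | α ≤ β ∧ β ≤ x ∧ Module.finrank F ↥β = i + 1},
              (if y.1 ⊓ x = β then (1 : ℂ) else 0))
          + (q : ℂ) ^ ((D : ℤ) - i) *
            (∑ᶠ β ∈ {β : Submodule F V | β ≤ x ∧ Module.finrank F ↥β = i ∧
                  Module.finrank F ↥(α ⊓ β) + 1 = i},
              (if y.1 ⊓ x = β then (1 : ℂ) else 0))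
          + qC q ((D : ℤ) - i + 1) *
            (∑ᶠ β ∈ {β : Submodule F V | β ≤ α ∧ Module.finrank F ↥β + 1 = i},
              (if y.1 ⊓ x = β then (1 : ℂ) else 0)) := by

  intro y
  subst hF
  rw [finsum_SS x α D hD y, finsum_ind, finsum_ind, finsum_ind]
  obtain ⟨y, hy⟩ := y
  simp only [Set.mem_ofPred]
  have hiD : i ≤ D := by rw [← hi, ← hx]; exact Submodule.finrank_mono hαx
  obtain ⟨k, rfl⟩ := Nat.exists_eq_add_of_le hiD
  obtain ⟨m, rfl⟩ := Nat.exists_eq_add_of_le hND.le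
  have hq := qC_ne (Fintype.one_lt_card (α := F))
  have hq0 : (Fintype.card F : ℂ) ≠ 0 := by exact_mod_cast Fintype.card_ne_zero
  have hgy := Submodule.finrank_mono (inf_le_left : y ⊓ x ≤ y)
  have hrecq : ∀ a : ℤ, qC (Fintype.card F) (a + 1) = Fintype.card F * qC (Fintype.card F) a + 1 := by
    intro a
    rw [qC, qC, zpow_add_one₀ hq0]
    field_simp
    ring
  by_cases c1 : y ⊓ x = α
  · rw [if_pos c1, if_neg, if_neg, if_neg]
    · have := case1 (x := x) (y := y) k (i + k + m) (by omega) (by rw [c1]; omega) (by omega)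
      rw [c1] at this
      rw [this]
      push_cast
      rw [hrecq]
      ring_nf
    · rintro ⟨-, h⟩
      rw [c1] at h; omega
    · rintro ⟨-, -, h⟩
      rw [c1, inf_idem] at h; omega
    · rintro ⟨-, -, h⟩
      rw [c1] at h; omega
  by_cases c2 : α ≤ y ⊓ x ∧ Module.finrank F ↥(y ⊓ x) = i + 1
  · obtain ⟨c2, c2'⟩ := c2
    rw [if_neg c1, if_pos ⟨c2, inf_le_right, c2'⟩, if_neg, if_neg]
    · obtain ⟨l, rfl⟩ : ∃ l, k = l + 1 := ⟨k - 1, by omega⟩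
      rw [case2 l (i + (l + 1) + m) (by omega) c2 (by omega) (by omega) (by omega)]
      have e1 : (2 * ((i + (l + 1) : ℕ) : ℤ) - 2 * i - 1) = ((2 * l + 1 : ℕ) : ℤ) := by
        push_cast; ring
      have e2 : (((2 * (i + (l + 1)) + m : ℕ) : ℤ) - 2 * ((i + (l + 1) : ℕ) : ℤ) + i + 1)
        = ((m + i + 1 : ℕ) : ℤ) := by
        push_cast; ring
      rw [e1, e2]
      simp only [qC, zpow_natCast]
      field_simp
      ring
    · rintro ⟨-, h⟩
      omega
    · rintro ⟨-, h, -⟩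
      omega
  by_cases c3 : Module.finrank F ↥(y ⊓ x) = i ∧ Module.finrank F ↥(α ⊓ (y ⊓ x)) + 1 = i
  · obtain ⟨c3, c3'⟩ := c3
    rw [if_neg c1, if_neg, if_pos ⟨inf_le_right, c3, c3'⟩, if_neg]
    · rw [inf_comm] at c3'
      rw [case3 hαx k (by omega) (by omega) (by omega)]
      have e1 : (((i + k : ℕ) : ℤ) - i) = (k : ℤ) := by push_cast; ring
      rw [e1, zpow_natCast]
      ring
    · rintro ⟨-, h⟩
      omega
    · rintro ⟨-, -, h⟩
      omega
  by_cases c4 : y ⊓ x ≤ α ∧ Module.finrank F ↥(y ⊓ x) + 1 = i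
  · rw [if_neg c1, if_neg, if_neg, if_pos c4]
    · rw [case4 hαx (k + 1) c4.1 (by omega) (by omega)]
      have e1 : (((i + k : ℕ) : ℤ) - i + 1) = ((k + 1 : ℕ) : ℤ) := by push_cast; ring
      rw [e1]
      ring
    · rintro ⟨-, h⟩
      omega
    · rintro ⟨-, -, h⟩
      omega
  rw [if_neg c1, if_neg (fun h => c2 ⟨h.1, h.2.2⟩), if_neg (fun h => c3 h.2), if_neg c4]
  have : SS x α y = ∅ := by
    rw [Set.eq_empty_iff_forall_notMem]
    intro z hz
    obtain ⟨h1, h2⟩ := nonzero hz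
    have hd1 := Submodule.finrank_mono (inf_le_left : y ⊓ x ⊓ α ≤ y ⊓ x)
    have hd2 := Submodule.finrank_mono (inf_le_right : y ⊓ x ⊓ α ≤ α)
    by_cases a1 : Module.finrank F ↥(y ⊓ x ⊓ α) = i
    · have b1 : y ⊓ x ⊓ α = α := Submodule.eq_of_le_of_finrank_eq inf_le_right (by omega)
      have b2 : α ≤ y ⊓ x := inf_eq_right.1 b1
      by_cases a2 : Module.finrank F ↥(y ⊓ x) = i
      · exact c1 (Submodule.eq_of_le_of_finrank_eq b2 (by omega)).symm
      · exact c2 ⟨b2, by omega⟩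
    · by_cases a2 : Module.finrank F ↥(y ⊓ x) = Module.finrank F ↥(y ⊓ x ⊓ α)
      · have b1 : y ⊓ x ⊓ α = y ⊓ x := Submodule.eq_of_le_of_finrank_eq inf_le_left a2.symm
        exact c4 ⟨inf_eq_left.1 b1, by omega⟩
      · refine c3 ⟨by omega, ?_⟩
        rw [inf_comm]
        omega
  rw [this]
  simp
end

section
/- Assume N > 2D, fix a vertex x ∈ X, and let α ⊆ x be a subspace with dim α = i. Then A* α^∨ = θ*_{D−i} α^∨ + (q^{−D+i+1}[N][N−1]/([D][N−D])) Σ_γ γ^∨, where the sum is over all subspaces γ with α ⊆ γ ⊆ x and dim γ = i + 1. -/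
open scoped Classical

/-- The dual eigenvalue
`θ*_j = -q[N-1]([D]+[N-D])/((q-1)[D][N-D]) + q^{1-j}[N][N-1]/((q-1)[D][N-D])`. -/
noncomputable def thetaStar (q N D : ℕ) (j : ℕ) : ℂ :=
  -(q : ℂ) * qC q ((N : ℤ) - 1) * (qC q D + qC q ((N : ℤ) - D)) /
      (((q : ℂ) - 1) * qC q D * qC q ((N : ℤ) - D))
    + (q : ℂ) ^ (1 - (j : ℤ)) * qC q N * qC q ((N : ℤ) - 1) /
      (((q : ℂ) - 1) * qC q D * qC q ((N : ℤ) - D))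

theorem aux_finrank {F V : Type*} [Field F] [AddCommGroup V] [Module F V]
    [FiniteDimensional F V] (α : Submodule F V) (v : V) (hv : v ∉ α) :
    Module.finrank F ↥(α ⊔ Submodule.span F {v}) = Module.finrank F ↥α + 1 := by
  have h := Submodule.finrank_sup_add_finrank_inf_eq α (Submodule.span F {v})
  have hv0 : v ≠ 0 := fun h0 => hv (h0 ▸ α.zero_mem)
  have hb : α ⊓ Submodule.span F {v} = ⊥ := by
    rw [← disjoint_iff]
    exact (Submodule.disjoint_span_singleton' hv0).2 hv
  rw [hb, finrank_bot, finrank_span_singleton hv0] at h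
  simpa using h

theorem aux_diff {F V : Type*} [Field F] [Fintype F] [AddCommGroup V] [Module F V]
    [FiniteDimensional F V] [Fintype V] (α W : Submodule F V) (h : α ≤ W) :
    (Finset.univ.filter (fun v : V => v ∈ W ∧ v ∉ α)).card + Fintype.card F ^ Module.finrank F α
      = Fintype.card F ^ Module.finrank F W := by
  have hc : ∀ U : Submodule F V, (Finset.univ.filter (fun v : V => v ∈ U)).card
      = Fintype.card F ^ Module.finrank F U := by
    intro U
    rw [← Module.card_eq_pow_finrank (K := F) (V := U), Fintype.card_subtype]
  rw [← hc α, ← hc W, ← Finset.card_union_of_disjoint]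
  · congr 1
    ext v
    simp only [Finset.mem_union, Finset.mem_filter, Finset.mem_univ, true_and]
    constructor
    · rintro (h1 | h1)
      · exact h1.1
      · exact h h1
    · intro h1
      by_cases h2 : v ∈ α
      · exact Or.inr h2
      · exact Or.inl ⟨h1, h2⟩
  · rw [Finset.disjoint_left]
    intro v hv hv2
    simp only [Finset.mem_filter, Finset.mem_univ, true_and] at hv hv2
    exact hv.2 hv2

theorem aux_count {F V : Type*} [Field F] [Fintype F] [AddCommGroup V] [Module F V]
    [FiniteDimensional F V] [Fintype V] (α W : Submodule F V) (h : α ≤ W)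
    (S : Finset (Submodule F V))
    (hS : ∀ γ, γ ∈ S ↔ α ≤ γ ∧ γ ≤ W ∧ Module.finrank F γ = Module.finrank F α + 1) :
    (S.card : ℂ) * ((Fintype.card F : ℂ) ^ (Module.finrank F α + 1)
      - (Fintype.card F : ℂ) ^ Module.finrank F α)
      = (Fintype.card F : ℂ) ^ Module.finrank F W - (Fintype.card F : ℂ) ^ Module.finrank F α := by
  have key := Finset.card_eq_sum_card_fiberwise
    (s := Finset.univ.filter (fun v : V => v ∈ W ∧ v ∉ α))
    (t := S) (f := fun v => α ⊔ Submodule.span F {v}) (by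
      intro v hv
      simp only [Finset.coe_filter, Finset.mem_univ, true_and, Set.mem_ofPred_eq] at hv
      simp only [Finset.mem_coe, hS]
      refine ⟨le_sup_left, sup_le h ?_, aux_finrank α v hv.2⟩
      rw [Submodule.span_singleton_le_iff_mem]
      exact hv.1)
  have hW := aux_diff α W h
  have hfib : ∀ γ ∈ S, (((Finset.univ.filter (fun v : V => v ∈ W ∧ v ∉ α)).filter
      (fun v => α ⊔ Submodule.span F {v} = γ)).card : ℂ) =
      (Fintype.card F : ℂ) ^ (Module.finrank F α + 1)
      - (Fintype.card F : ℂ) ^ Module.finrank F α := by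
    intro γ hγ
    obtain ⟨h1, h2, h3⟩ := (hS γ).1 hγ
    have hd := aux_diff α γ h1
    rw [h3] at hd
    have he : (Finset.univ.filter (fun v : V => v ∈ W ∧ v ∉ α)).filter
      (fun v => α ⊔ Submodule.span F {v} = γ) =
      Finset.univ.filter (fun v : V => v ∈ γ ∧ v ∉ α) := by
      ext v
      simp only [Finset.mem_filter, Finset.mem_univ, true_and]
      constructor
      · rintro ⟨⟨_, h5⟩, rfl⟩
        exact ⟨Submodule.mem_sup_right (Submodule.mem_span_singleton_self v), h5⟩
      · rintro ⟨h4, h5⟩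
        refine ⟨⟨h2 h4, h5⟩, ?_⟩
        apply Submodule.eq_of_le_of_finrank_eq
        · exact sup_le h1 ((Submodule.span_singleton_le_iff_mem _ _).2 h4)
        · rw [aux_finrank α v h5, h3]
    rw [he, eq_sub_iff_add_eq]
    exact_mod_cast hd
  have hW' : ((Finset.univ.filter (fun v : V => v ∈ W ∧ v ∉ α)).card : ℂ) =
      (Fintype.card F : ℂ) ^ Module.finrank F W - (Fintype.card F : ℂ) ^ Module.finrank F α := by
    rw [eq_sub_iff_add_eq]
    exact_mod_cast hW
  rw [← hW', key, Nat.cast_sum, Finset.sum_congr rfl hfib, Finset.sum_const, nsmul_eq_mul]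

/-- Assume `N > 2D`, fix a vertex `x` of the Grassmann graph `J_q(N,D)`, and let `α ⊆ x` with
`dim α = i`. Then `A* α^∨ = θ*_{D-i} α^∨ + (q^{-D+i+1}[N][N-1]/([D][N-D])) Σ_γ γ^∨`, where
the dual adjacency operator acts by `(A* f)(y) = θ*_{D - dim(x ∩ y)} f(y)` and the sum is over
all subspaces `γ` with `α ⊆ γ ⊆ x` and `dim γ = i + 1`. -/
theorem stmt14 (q : ℕ) (F : Type*) [Field F] [Fintype F] (hF : Fintype.card F = q)
    (N D : ℕ) (hD : 1 ≤ D) (hND : 2 * D < N)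
    (V : Type*) [AddCommGroup V] [Module F V] [FiniteDimensional F V]
    (hV : Module.finrank F V = N)
    (x : Submodule F V) (hx : Module.finrank F ↥x = D)
    (α : Submodule F V) (hαx : α ≤ x) (i : ℕ) (hi : Module.finrank F ↥α = i) :
    ∀ y : {W : Submodule F V // Module.finrank F ↥W = D},
      thetaStar q N D (D - Module.finrank F ↥(x ⊓ y.1)) *
          (if α ≤ y.1 then (1 : ℂ) else 0)
        = thetaStar q N D (D - i) * (if α ≤ y.1 then (1 : ℂ) else 0)
          + ((q : ℂ) ^ (-(D : ℤ) + i + 1) * qC q N * qC q ((N : ℤ) - 1) /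
              (qC q D * qC q ((N : ℤ) - D))) *
            ∑ᶠ γ ∈ {γ : Submodule F V | α ≤ γ ∧ γ ≤ x ∧ Module.finrank F ↥γ = i + 1},
              (if γ ≤ y.1 then (1 : ℂ) else 0) := by
  intro y
  have : Finite V := Module.finite_of_finite F
  have : Fintype V := Fintype.ofFinite V
  have : Finite (Submodule F V) := Finite.of_injective (fun U => (U : Set V)) SetLike.coe_injective
  have : Fintype (Submodule F V) := Fintype.ofFinite _
  have hsum : ∑ᶠ γ ∈ {γ : Submodule F V | α ≤ γ ∧ γ ≤ x ∧ Module.finrank F ↥γ = i + 1},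
      (if γ ≤ y.1 then (1 : ℂ) else 0) =
      ((Finset.univ.filter (fun γ : Submodule F V =>
        α ≤ γ ∧ γ ≤ x ⊓ y.1 ∧ Module.finrank F ↥γ = i + 1)).card : ℂ) := by
    rw [finsum_mem_eq_finite_toFinset_sum _ (Set.toFinite _), Finset.sum_boole]
    congr 2
    ext γ
    simp only [Finset.mem_filter, Set.Finite.mem_toFinset, Set.mem_ofPred_eq, Finset.mem_univ,
      true_and, le_inf_iff]
    tauto
  rw [hsum]
  by_cases hy : α ≤ y.1
  · have hle : α ≤ x ⊓ y.1 := le_inf hαx hy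
    have hc := aux_count α (x ⊓ y.1) hle (Finset.univ.filter (fun γ : Submodule F V =>
        α ≤ γ ∧ γ ≤ x ⊓ y.1 ∧ Module.finrank F ↥γ = i + 1)) (by
          intro γ
          simp [hi])
    rw [hF, hi] at hc
    have hq : 1 < q := hF ▸ Fintype.one_lt_card
    have hq0 : (q : ℂ) ≠ 0 := by exact_mod_cast (by omega : q ≠ 0)
    have hq1 : (q : ℂ) - 1 ≠ 0 := by
      rw [sub_ne_zero]
      exact_mod_cast (by omega : q ≠ 1)
    have hiD : i ≤ D := by
      rw [← hi, ← hx]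
      exact Submodule.finrank_mono hαx
    have hmD : Module.finrank F ↥(x ⊓ y.1) ≤ D :=
      (Submodule.finrank_mono inf_le_left).trans hx.le
    generalize ((Finset.univ.filter (fun γ : Submodule F V =>
        α ≤ γ ∧ γ ≤ x ⊓ y.1 ∧ Module.finrank F ↥γ = i + 1)).card : ℂ) = c at hc ⊢
    generalize Module.finrank F ↥(x ⊓ y.1) = m at hc hmD ⊢
    simp only [hy, if_true, mul_one]
    unfold thetaStar
    have e : ∀ k : ℕ, k ≤ D → (q : ℂ) ^ (1 - ((D - k : ℕ) : ℤ)) =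
        (q : ℂ) ^ (1 - (D : ℤ)) * (q : ℂ) ^ k := by
      intro k hk
      rw [← zpow_natCast, ← zpow_add₀ hq0]
      congr 1
      omega
    have e2 : (q : ℂ) ^ (-(D : ℤ) + i + 1) = (q : ℂ) ^ (1 - (D : ℤ)) * (q : ℂ) ^ i := by
      rw [← zpow_natCast, ← zpow_add₀ hq0]
      congr 1
      omega
    rw [e m hmD, e i hiD, e2]
    have hm : (q : ℂ) ^ m = (q : ℂ) ^ i + c * (q : ℂ) ^ i * ((q : ℂ) - 1) := by
      rw [pow_succ] at hc
      linear_combination -hc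
    rw [hm, add_assoc]
    congr 1
    generalize qC q N = a
    generalize qC q ((N : ℤ) - 1) = b
    generalize hB : (q : ℂ) - 1 = r at *
    rw [mul_assoc r, div_mul_eq_div_div, div_mul_eq_div_div]
    simp only [div_eq_mul_inv]
    have : r * r⁻¹ = 1 := mul_inv_cancel₀ hq1
    linear_combination (q : ℂ) ^ (1 - (D : ℤ)) * (q : ℂ) ^ i * c * a * b *
      (qC q D * qC q ((N : ℤ) - D))⁻¹ * this
  · have h0 : (Finset.univ.filter (fun γ : Submodule F V =>
        α ≤ γ ∧ γ ≤ x ⊓ y.1 ∧ Module.finrank F ↥γ = i + 1)) = ∅ := by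
      rw [Finset.filter_eq_empty_iff]
      rintro γ - ⟨h1, h2, -⟩
      exact hy (h1.trans (h2.trans inf_le_right))
    rw [h0]
    simp [hy]
end

section
/- Assume N > 2D, fix a vertex x ∈ X, and let α ⊆ x be a subspace with dim α = i. Then the operator (A − θ_0 I)(A − θ_1 I)⋯(A − θ_i I) annihilates α^∨, where θ_j = q[D][N−D] − [j][N−j+1] for 0 ≤ j ≤ i and I is the identity operator on C^X. Equivalently, α^∨ lies in the sum of the eigenspaces of A for the eigenvalues θ_0, θ_1, …, θ_i. -/
open scoped Classical

/-- The eigenvalue `θ_j = q[D][N-D] - [j][N-j+1]` of the Grassmann graph `J_q(N,D)`. -/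
noncomputable def theta (q N D : ℕ) (j : ℕ) : ℂ :=
  (q : ℂ) * qC q D * qC q ((N : ℤ) - D) - qC q j * qC q ((N : ℤ) - j + 1)


section Helpers
open Module

/-- natural q-number -/
def gN (q n : ℕ) : ℕ := ∑ i ∈ Finset.range n, q ^ i

lemma points_ncard (F E : Type*) [Field F] [Fintype F] [AddCommGroup E] [Module F E] :
    {H : Submodule F E | finrank F H = 1}.ncard = gN (Fintype.card F) (finrank F E) := by
  have h := Projectivization.card_of_finrank F E rfl
  rw [Nat.card_congr (Projectivization.equivSubmodule F E)] at h
  rw [gN, ← Nat.card_eq_fintype_card, ← h]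
  rfl

lemma hyper1 (F E : Type*) [Field F] [Fintype F] [AddCommGroup E] [Module F E]
    [FiniteDimensional F E] :
    {H : Submodule F E | finrank F H + 1 = finrank F E}.ncard
      = gN (Fintype.card F) (finrank F E) := by
  rw [← Subspace.dual_finrank_eq (K := F) (V := E), ← points_ncard F (Dual F E)]
  have : {H : Submodule F E | finrank F H + 1 = finrank F (Dual F E)}
      = (fun L : Submodule F (Dual F E) => L.dualCoannihilator) ''
        {L | finrank F L = 1} := by
    ext H
    simp only [Set.mem_ofPred_eq, Set.mem_image]
    constructor
    · intro h
      refine ⟨H.dualAnnihilator, ?_, Subspace.dualAnnihilator_dualCoannihilator_eq⟩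
      have := Subspace.finrank_add_finrank_dualAnnihilator_eq H
      rw [Subspace.dual_finrank_eq] at h
      omega
    · rintro ⟨L, hL, rfl⟩
      have := Subspace.finrank_add_finrank_dualCoannihilator_eq L
      rw [Subspace.dual_finrank_eq]
      omega
  rw [this, Set.ncard_image_of_injective]
  intro L M h
  have := congrArg Submodule.dualAnnihilator h
  simpa [Subspace.dualCoannihilator_dualAnnihilator_eq] using this

lemma finrank_comap_mkQ' {F E : Type*} [Field F] [AddCommGroup E] [Module F E]
    [FiniteDimensional F E] (w : Submodule F E) (H : Submodule F (E ⧸ w)) :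
    finrank F (H.comap w.mkQ) = finrank F H + finrank F w := by
  have h1 := Submodule.finrank_quotient_add_finrank (H.comap w.mkQ)
  have h2 := Submodule.finrank_quotient_add_finrank H
  have h3 := Submodule.finrank_quotient_add_finrank w
  have h4 := (Submodule.quotientQuotientEquivQuotient w (H.comap w.mkQ)
    (Submodule.le_comap_mkQ w H)).finrank_eq
  rw [Submodule.map_comap_eq_of_surjective (Submodule.mkQ_surjective w)] at h4
  omega

lemma hyper2 {F E : Type*} [Field F] [Fintype F] [AddCommGroup E] [Module F E]
    [FiniteDimensional F E] (a : Submodule F E) :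
    {H : Submodule F E | a ≤ H ∧ finrank F H + 1 = finrank F E}.ncard
      = gN (Fintype.card F) (finrank F E - finrank F a) := by
  have h3 := Submodule.finrank_quotient_add_finrank a
  rw [← Nat.eq_sub_of_add_eq h3, ← hyper1 F (E ⧸ a)]
  have : {H : Submodule F E | a ≤ H ∧ finrank F H + 1 = finrank F E}
      = (Submodule.comap a.mkQ) '' {H | finrank F H + 1 = finrank F (E ⧸ a)} := by
    ext H
    simp only [Set.mem_ofPred_eq, Set.mem_image]
    constructor
    · rintro ⟨h, h'⟩
      have e : (H.map a.mkQ).comap a.mkQ = H := by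
        rw [Submodule.comap_map_mkQ, sup_eq_right.2 h]
      refine ⟨H.map a.mkQ, ?_, e⟩
      have := finrank_comap_mkQ' a (H.map a.mkQ)
      rw [e] at this
      omega
    · rintro ⟨L, hL, rfl⟩
      have := finrank_comap_mkQ' a L
      exact ⟨Submodule.le_comap_mkQ a L, by omega⟩
  rw [this, Set.ncard_image_of_injective]
  exact Submodule.comap_injective_of_surjective (Submodule.mkQ_surjective a)

lemma covers {F E : Type*} [Field F] [Fintype F] [AddCommGroup E] [Module F E]
    [FiniteDimensional F E] (a : Submodule F E) :
    {H : Submodule F E | a ≤ H ∧ finrank F H = finrank F a + 1}.ncard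
      = gN (Fintype.card F) (finrank F E - finrank F a) := by
  have h3 := Submodule.finrank_quotient_add_finrank a
  rw [← Nat.eq_sub_of_add_eq h3, ← points_ncard F (E ⧸ a)]
  have : {H : Submodule F E | a ≤ H ∧ finrank F H = finrank F a + 1}
      = (Submodule.comap a.mkQ) '' {H | finrank F H = 1} := by
    ext H
    simp only [Set.mem_ofPred_eq, Set.mem_image]
    constructor
    · rintro ⟨h, h'⟩
      have e : (H.map a.mkQ).comap a.mkQ = H := by
        rw [Submodule.comap_map_mkQ, sup_eq_right.2 h]
      refine ⟨H.map a.mkQ, ?_, e⟩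
      have := finrank_comap_mkQ' a (H.map a.mkQ)
      rw [e] at this
      omega
    · rintro ⟨L, hL, rfl⟩
      have := finrank_comap_mkQ' a L
      exact ⟨Submodule.le_comap_mkQ a L, by omega⟩
  rw [this, Set.ncard_image_of_injective]
  exact Submodule.comap_injective_of_surjective (Submodule.mkQ_surjective a)

lemma hyper3 {F E : Type*} [Field F] [Fintype F] [AddCommGroup E] [Module F E]
    [FiniteDimensional F E] (a y : Submodule F E) (hay : a ≤ y) :
    {H : Submodule F E | a ≤ H ∧ H ≤ y ∧ finrank F H + 1 = finrank F y}.ncard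
      = gN (Fintype.card F) (finrank F y - finrank F a) := by
  have h := hyper2 (a.comap y.subtype)
  have e : finrank F (a.comap y.subtype) = finrank F a :=
    (Submodule.comapSubtypeEquivOfLe hay).finrank_eq
  rw [e] at h
  rw [← h]
  have : {H : Submodule F E | a ≤ H ∧ H ≤ y ∧ finrank F H + 1 = finrank F y}
      = (Submodule.map y.subtype) ''
        {H | a.comap y.subtype ≤ H ∧ finrank F H + 1 = finrank F y} := by
    ext H
    simp only [Set.mem_ofPred_eq, Set.mem_image]
    constructor
    · rintro ⟨h1, h2, h3⟩
      refine ⟨H.comap y.subtype, ⟨Submodule.comap_mono h1, ?_⟩, ?_⟩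
      · rw [(Submodule.comapSubtypeEquivOfLe h2).finrank_eq, h3]
      · rw [Submodule.map_comap_subtype, inf_eq_right.2 h2]
    · rintro ⟨L, ⟨h1, h2⟩, rfl⟩
      refine ⟨?_, Submodule.map_subtype_le y L, ?_⟩
      · intro t ht
        exact ⟨⟨t, hay ht⟩, h1 ht, rfl⟩
      · rw [Submodule.finrank_map_subtype_eq, h2]
  rw [this, Set.ncard_image_of_injective]
  exact Submodule.map_injective_of_injective y.injective_subtype

variable {F E : Type*} [Field F] [Fintype F] [AddCommGroup E] [Module F E]
    [FiniteDimensional F E]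

lemma gN_succ (q n : ℕ) : gN q (n+1) = q * gN q n + 1 := by
  simp [gN, Finset.sum_range_succ', Finset.mul_sum, pow_succ']

lemma count_adj (a y : Submodule F E) (hay : a ≤ y) :
    {z : Submodule F E | finrank F z = finrank F y ∧
      (finrank F (y ⊓ z : Submodule F E) + 1 = finrank F y ∧ a ≤ z)}.ncard
    = gN (Fintype.card F) (finrank F y - finrank F a) *
      (Fintype.card F * gN (Fintype.card F) (finrank F E - finrank F y)) := by
  have : Finite E := Module.finite_of_finite F
  have : Fintype (Submodule F E) := Fintype.ofFinite _
  rw [← hyper3 a y hay, Set.ncard_eq_toFinset_card', Set.ncard_eq_toFinset_card',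
    Finset.card_eq_sum_card_fiberwise (f := fun z => y ⊓ z)
      (t := {H : Submodule F E | a ≤ H ∧ H ≤ y ∧ finrank F H + 1 = finrank F y}.toFinset)]
  · rw [Finset.sum_const_nat]
    intro w hw
    simp only [Set.mem_toFinset, Set.mem_ofPred_eq] at hw
    obtain ⟨h1, h2, h3⟩ := hw
    have hc := covers w
    have hyE := Submodule.finrank_le y
    rw [show finrank F E - finrank F w = (finrank F E - finrank F y) + 1 by omega,
      gN_succ] at hc
    have hym : y ∈ {H : Submodule F E | w ≤ H ∧ finrank F H = finrank F w + 1} := ⟨h2, h3.symm⟩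
    have := Set.ncard_sdiff_singleton_of_mem hym
    rw [hc, Nat.add_sub_cancel] at this
    rw [← this, ← Set.ncard_coe_finset]
    congr 1
    ext z
    simp only [Finset.coe_filter, Set.mem_toFinset, Set.mem_ofPred_eq, Set.mem_sdiff,
      Set.mem_singleton_iff]
    constructor
    · rintro ⟨⟨h4, h5, h6⟩, rfl⟩
      refine ⟨⟨inf_le_right, by omega⟩, ?_⟩
      intro hzy
      rw [hzy, inf_idem] at h3
      omega
    · rintro ⟨⟨h4, h5⟩, h6⟩
      have : y ⊓ z = w := by
        symm
        apply Submodule.eq_of_le_of_finrank_le (le_inf h2 h4)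
        by_contra hlt
        apply h6
        have hle : y ≤ z := by
          rw [← inf_eq_left]
          exact Submodule.eq_of_le_of_finrank_le inf_le_left (by omega)
        exact (Submodule.eq_of_le_of_finrank_le hle (by omega)).symm
      refine ⟨⟨by omega, by rw [this]; exact h3, h1.trans h4⟩, this⟩
  · intro z hz
    simp only [Set.coe_toFinset, Set.mem_ofPred_eq] at hz ⊢
    exact ⟨le_inf hay hz.2.2, inf_le_left, hz.2.1⟩

lemma adj_not_le (a y z : Submodule F E) (hay : ¬ a ≤ y) (h1 : finrank F z = finrank F y)
    (h2 : finrank F (y ⊓ z : Submodule F E) + 1 = finrank F y) (h3 : a ≤ z) :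
    finrank F (a ⊓ y : Submodule F E) + 1 = finrank F a ∧ (y ⊓ z) ⊔ a = z := by
  have e : (y ⊓ z) ⊓ a = a ⊓ y := by
    rw [inf_assoc, inf_eq_right.2 h3, inf_comm]
  have hd := Submodule.finrank_sup_add_finrank_inf_eq (y ⊓ z) a
  rw [e] at hd
  have hlt : finrank F (a ⊓ y : Submodule F E) < finrank F a :=
    Submodule.finrank_lt_finrank_of_lt (lt_of_le_of_ne inf_le_left (by simpa using hay))
  have hle : (y ⊓ z) ⊔ a ≤ z := sup_le inf_le_right h3
  have := Submodule.finrank_mono hle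
  exact ⟨by omega, Submodule.eq_of_le_of_finrank_le hle (by omega)⟩

lemma count_adj_not (a y : Submodule F E) (hay : ¬ a ≤ y) :
    {z : Submodule F E | finrank F z = finrank F y ∧
      (finrank F (y ⊓ z : Submodule F E) + 1 = finrank F y ∧ a ≤ z)}.ncard
    = if finrank F (a ⊓ y : Submodule F E) + 1 = finrank F a then
      gN (Fintype.card F) (finrank F y + 1 - finrank F a) else 0 := by
  split_ifs with h
  · rw [show finrank F y + 1 - finrank F a = finrank F y - finrank F (a ⊓ y : Submodule F E)
      by omega, ← hyper3 (a ⊓ y) y inf_le_right]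
    have key : ∀ w : Submodule F E, a ⊓ y ≤ w → w ≤ y → finrank F w + 1 = finrank F y →
        finrank F (w ⊔ a : Submodule F E) = finrank F y ∧ y ⊓ (w ⊔ a) = w := by
      intro w h1 h2 h3
      have hd := Submodule.finrank_sup_add_finrank_inf_eq w a
      have e : w ⊓ a = a ⊓ y := le_antisymm (le_inf inf_le_right (inf_le_left.trans h2))
        (le_inf h1 inf_le_left)
      rw [e] at hd
      refine ⟨by omega, ?_⟩
      symm
      apply Submodule.eq_of_le_of_finrank_le (le_inf h2 le_sup_left)
      by_contra hlt
      have hle : y ≤ w ⊔ a := by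
        rw [← inf_eq_left]
        exact Submodule.eq_of_le_of_finrank_le inf_le_left (by omega)
      have := Submodule.eq_of_le_of_finrank_le hle (by omega)
      exact hay (this ▸ le_sup_right)
    rw [← Set.ncard_image_of_injOn (f := fun w => w ⊔ a)
      (s := {H : Submodule F E | a ⊓ y ≤ H ∧ H ≤ y ∧ finrank F H + 1 = finrank F y})]
    · congr 1
      ext z
      simp only [Set.mem_ofPred_eq, Set.mem_image]
      constructor
      · rintro ⟨h1, h2, h3⟩
        exact ⟨y ⊓ z, ⟨le_inf inf_le_right (inf_le_left.trans h3), inf_le_left, h2⟩,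
          (adj_not_le a y z hay h1 h2 h3).2⟩
      · rintro ⟨w, ⟨h1, h2, h3⟩, rfl⟩
        obtain ⟨k1, k2⟩ := key w h1 h2 h3
        exact ⟨k1, by rw [k2]; exact h3, le_sup_right⟩
    · rintro w ⟨h1, h2, h3⟩ w' ⟨h1', h2', h3'⟩ hww
      rw [← (key w h1 h2 h3).2, ← (key w' h1' h2' h3').2]
      exact congrArg (y ⊓ ·) hww
  · have : Finite E := Module.finite_of_finite F
    rw [Set.ncard_eq_zero]
    ext z
    simp only [Set.mem_ofPred_eq, Set.mem_empty_iff_false, iff_false]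
    rintro ⟨h1, h2, h3⟩
    exact h (adj_not_le a y z hay h1 h2 h3).1

lemma count_sub (a y : Submodule F E) :
    {b : Submodule F E | (b ≤ a ∧ finrank F b + 1 = finrank F a) ∧ b ≤ y}.ncard
    = if a ≤ y then gN (Fintype.card F) (finrank F a) else
      if finrank F (a ⊓ y : Submodule F E) + 1 = finrank F a then 1 else 0 := by
  split_ifs with h h'
  · have := hyper3 (⊥ : Submodule F E) a bot_le
    rw [finrank_bot, Nat.sub_zero] at this
    rw [← this]
    congr 1
    ext b
    simp only [Set.mem_ofPred_eq, bot_le, true_and]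
    exact ⟨fun h => h.1, fun k => ⟨k, k.1.trans h⟩⟩
  · rw [Set.ncard_eq_one]
    refine ⟨a ⊓ y, ?_⟩
    ext b
    simp only [Set.mem_ofPred_eq, Set.mem_singleton_iff]
    constructor
    · rintro ⟨⟨h1, h2⟩, h3⟩
      exact Submodule.eq_of_le_of_finrank_le (le_inf h1 h3) (by omega)
    · rintro rfl
      exact ⟨⟨inf_le_left, h'⟩, inf_le_right⟩
  · have : Finite E := Module.finite_of_finite F
    rw [Set.ncard_eq_zero]
    ext b
    simp only [Set.mem_ofPred_eq, Set.mem_empty_iff_false, iff_false]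
    rintro ⟨⟨h1, h2⟩, h3⟩
    have k1 := Submodule.finrank_mono (le_inf h1 h3)
    have hlt : finrank F (a ⊓ y : Submodule F E) < finrank F a :=
      Submodule.finrank_lt_finrank_of_lt (lt_of_le_of_ne inf_le_left (by simpa using h))
    omega

end Helpers

section Main
open Module

lemma qC_eq (q : ℕ) (hq : 1 < q) (n : ℕ) (m : ℤ) (h : m = n) : qC q m = (gN q n : ℂ) := by
  subst h
  have hq' : (q : ℂ) ≠ 1 := by
    intro h
    have : q = 1 := by exact_mod_cast h
    omega
  rw [qC, gN]
  push_cast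
  rw [geom_sum_eq hq', zpow_natCast]

lemma theta_identity (q : ℕ) (hq : 1 < q) (N D i : ℕ) (hi : i ≤ D) (hN : D ≤ N) :
    (gN q (D - i) : ℂ) * (q * gN q (N - D)) - theta q N D i
      = gN q (D + 1 - i) * gN q i := by
  obtain ⟨k, rfl⟩ := Nat.exists_eq_add_of_le hi
  obtain ⟨m, rfl⟩ := Nat.exists_eq_add_of_le hN
  have hq' : (q : ℂ) - 1 ≠ 0 := by
    intro h
    have h : (q : ℂ) = 1 := by linear_combination h
    have : q = 1 := by exact_mod_cast h
    omega
  rw [theta, qC_eq q hq (i + k) _ rfl, qC_eq q hq m _ (by push_cast; ring),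
    qC_eq q hq i _ rfl, qC_eq q hq (k + m + 1) _ (by push_cast; ring),
    show i + k - i = k by omega, show i + k + m - (i + k) = m by omega,
    show i + k + 1 - i = k + 1 by omega]
  have hg : ∀ n, (gN q n : ℂ) = ((q : ℂ) ^ n - 1) / ((q : ℂ) - 1) := by
    intro n
    rw [← qC_eq q hq n n rfl, qC, zpow_natCast]
  simp only [hg]
  field_simp
  ring

variable {F V : Type*} [Field F] [Fintype F] [AddCommGroup V] [Module F V]
    [FiniteDimensional F V]

lemma sum_ind (D : ℕ) [Fintype (Submodule F V)] [Fintype {W : Submodule F V // finrank F W = D}]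
    (P : Submodule F V → Prop) :
    (∑ z : {W : Submodule F V // finrank F W = D}, if P z.1 then (1 : ℂ) else 0)
      = ({z : Submodule F V | finrank F z = D ∧ P z}.ncard : ℂ) := by
  rw [Finset.sum_boole, ← Set.ncard_coe_finset,
    ← Set.ncard_image_of_injective _ Subtype.val_injective]
  congr 2
  ext z
  simp [and_comm]

/-- indicator -/
noncomputable def indV (D : ℕ) (a : Submodule F V) :
    {W : Submodule F V // finrank F W = D} → ℂ := fun y => if a ≤ y.1 then 1 else 0

/-- adjacency -/
noncomputable def adjOp (F V : Type*) [Field F] [AddCommGroup V] [Module F V] (D : ℕ)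
    [Fintype {W : Submodule F V // finrank F W = D}] :
    ({W : Submodule F V // finrank F W = D} → ℂ) →ₗ[ℂ]
    ({W : Submodule F V // finrank F W = D} → ℂ) where
  toFun f y := ∑ z, if finrank F (y.1 ⊓ z.1 : Submodule F V) = D - 1 then f z else 0
  map_add' f g := by
    ext y
    simp only [Pi.add_apply, ← Finset.sum_add_distrib]
    refine Finset.sum_congr rfl fun z _ => ?_
    split_ifs <;> simp
  map_smul' c f := by
    ext y
    simp [Finset.mul_sum]

lemma adj_ind (q N D : ℕ) (hF : Fintype.card F = q) (hD : 1 ≤ D) (hND : D ≤ N)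
    (hV : finrank F V = N) [Fintype (Submodule F V)]
    [Fintype {W : Submodule F V // finrank F W = D}]
    (a : Submodule F V) (ha : finrank F a ≤ D) :
    adjOp F V D (indV D a) - theta q N D (finrank F a) • indV D a
      = (gN q (D + 1 - finrank F a) : ℂ) •
        ∑ b : Submodule F V with (b ≤ a ∧ finrank F b + 1 = finrank F a), indV D b := by
  have hq : 1 < q := hF ▸ Fintype.one_lt_card
  ext ⟨y, hy⟩
  simp only [Pi.sub_apply, Pi.smul_apply, smul_eq_mul, Finset.sum_apply]
  have h1 : adjOp F V D (indV D a) ⟨y, hy⟩ = (({z : Submodule F V | finrank F z = finrank F y ∧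
      (finrank F (y ⊓ z : Submodule F V) + 1 = finrank F y ∧ a ≤ z)}.ncard : ℕ) : ℂ) := by
    rw [hy, ← sum_ind]
    simp only [adjOp, indV, LinearMap.coe_mk, AddHom.coe_mk]
    refine Finset.sum_congr rfl fun z _ => ?_
    have : finrank F (y ⊓ z.1 : Submodule F V) = D - 1 ↔
      finrank F (y ⊓ z.1 : Submodule F V) + 1 = D := by omega
    simp only [this]
    split_ifs <;> first | rfl | (exfalso; tauto)
  have h2 : (∑ b : Submodule F V with (b ≤ a ∧ finrank F b + 1 = finrank F a),
      indV D b ⟨y, hy⟩) = (({b : Submodule F V | (b ≤ a ∧ finrank F b + 1 = finrank F a) ∧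
        b ≤ y}.ncard : ℕ) : ℂ) := by
    simp only [indV]
    rw [Finset.sum_boole, ← Set.ncard_coe_finset]
    congr 2
    ext z
    simp
  rw [h1, h2, count_sub]
  by_cases h : a ≤ y
  · rw [count_adj a y h, if_pos h, hF, hV, hy]
    simp only [indV, if_pos h, mul_one]
    push_cast
    exact theta_identity q hq N D _ ha hND
  · rw [count_adj_not a y h, if_neg h, hF, hy]
    simp only [indV, if_neg h, mul_zero, sub_zero]
    split_ifs <;> simp

lemma main_aux (q N D : ℕ) (hF : Fintype.card F = q) (hD : 1 ≤ D) (hND : D ≤ N)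
    (hV : finrank F V = N) [Fintype (Submodule F V)]
    [Fintype {W : Submodule F V // finrank F W = D}] (i : ℕ) (hi : i ≤ D) :
    ∀ v : ℕ → ({W : Submodule F V // finrank F W = D} → ℂ),
      v 0 ∈ Submodule.span ℂ (indV D '' {a : Submodule F V | finrank F a = i}) →
      (∀ j, j ≤ i → v (j + 1) = adjOp F V D (v j) - theta q N D (i - j) • v j) →
      v (i + 1) = 0 := by
  induction i with
  | zero =>
    intro v h0 hv
    rw [hv 0 le_rfl]
    generalize v 0 = f at h0
    induction h0 using Submodule.span_induction with
    | mem f hf =>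
      obtain ⟨a, ha, rfl⟩ := hf
      have ha : finrank F a = 0 := ha
      have := adj_ind q N D hF hD hND hV a (by omega)
      rw [ha] at this
      simpa using this
    | zero => simp
    | add f g _ _ hf hg =>
      rw [map_add, smul_add, add_sub_add_comm, hf, hg, add_zero]
    | smul c f _ hf =>
      rw [map_smul, smul_comm, ← smul_sub, hf, smul_zero]
  | succ i ih =>
    intro v h0 hv
    refine ih (by omega) (fun j => v (j + 1)) ?_ ?_
    · show v 1 ∈ _
      rw [hv 0 (by omega)]
      generalize v 0 = f at h0
      induction h0 using Submodule.span_induction with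
      | mem f hf =>
        obtain ⟨a, ha, rfl⟩ := hf
        have ha : finrank F a = i + 1 := ha
        have := adj_ind q N D hF hD hND hV a (by omega)
        rw [ha] at this
        rw [Nat.sub_zero, this]
        refine Submodule.smul_mem _ _ (Submodule.sum_mem _ fun b hb => ?_)
        refine Submodule.subset_span ⟨b, ?_, rfl⟩
        have := (Finset.mem_filter.1 hb).2.2
        show finrank F b = i
        omega
      | zero => simp
      | add f g _ _ hf hg =>
        rw [map_add, smul_add, add_sub_add_comm]
        exact Submodule.add_mem _ hf hg
      | smul c f _ hf =>
        rw [map_smul, smul_comm, ← smul_sub]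
        exact Submodule.smul_mem _ _ hf
    · intro j hj
      show v (j + 1 + 1) = _
      rw [hv (j + 1) (by omega), show i + 1 - (j + 1) = i - j by omega]

end Main

/-- Assume `N > 2D`, fix a vertex `x` of the Grassmann graph `J_q(N,D)`, and let `α ⊆ x` with
`dim α = i`. Then the operator `(A - θ_0 I)(A - θ_1 I)⋯(A - θ_i I)` annihilates `α^∨`, where
`(A f)(y) = Σ_{z adjacent to y} f(z)`. This is encoded via the sequence `v 0 = α^∨`,
`v (j+1) = (A - θ_{i-j} I) (v j)` (applying the rightmost factor first); the claim is
`v (i+1) = 0`. -/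
theorem stmt15 (q : ℕ) (F : Type*) [Field F] [Fintype F] (hF : Fintype.card F = q)
    (N D : ℕ) (hD : 1 ≤ D) (hND : 2 * D < N)
    (V : Type*) [AddCommGroup V] [Module F V] [FiniteDimensional F V]
    (hV : Module.finrank F V = N)
    (x : Submodule F V) (hx : Module.finrank F ↥x = D)
    (α : Submodule F V) (hαx : α ≤ x) (i : ℕ) (hi : Module.finrank F ↥α = i)
    (v : ℕ → ({W : Submodule F V // Module.finrank F ↥W = D} → ℂ))
    (hv0 : v 0 = fun y => if α ≤ y.1 then (1 : ℂ) else 0)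
    (hv : ∀ j, v (j + 1) = fun y =>
        (∑ᶠ z ∈ {z : {W : Submodule F V // Module.finrank F ↥W = D} |
            Module.finrank F ↥(y.1 ⊓ z.1) = D - 1}, v j z)
          - theta q N D (i - j) * v j y) :
    v (i + 1) = 0 := by
  have : Finite V := Module.finite_of_finite F
  have : Fintype (Submodule F V) := Fintype.ofFinite _
  have : Fintype {W : Submodule F V // Module.finrank F W = D} := Fintype.ofFinite _
  have hiD : i ≤ D := by
    rw [← hi, ← hx]
    exact Submodule.finrank_mono hαx
  refine main_aux q N D hF hD (by omega) hV i hiD v ?_ ?_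
  · rw [hv0]
    exact Submodule.subset_span ⟨α, hi, rfl⟩
  · intro j _
    rw [hv j]
    ext y
    simp only [Pi.sub_apply, Pi.smul_apply, smul_eq_mul, adjOp, LinearMap.coe_mk, AddHom.coe_mk]
    congr 1
    rw [finsum_mem_eq_finite_toFinset_sum _ (Set.toFinite _), ← Finset.sum_filter]
    refine Finset.sum_congr ?_ fun _ _ => rfl
    ext z
    simp
end

section
/- Let α be an i-dimensional subspace of V with 0 ≤ i ≤ D, and let y be a D-dimensional subspace of V with α ⊆ y. Then the number of D-dimensional subspaces z of V with α ⊆ z and dim(y ∩ z) = D − 1 equals q[D−i][N−D]. -/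
/-- The `q`-integer `[m] = (q^m - 1)/(q - 1)` as a real number. -/
noncomputable def qInt (q : ℝ) (m : ℤ) : ℝ := (q ^ m - 1) / (q - 1)

open Classical in
lemma card_sub {F V : Type*} [Field F] [Fintype F] [AddCommGroup V] [Module F V]
    [FiniteDimensional F V] [Fintype V] (W : Submodule F V) :
    (Finset.univ.filter (fun v : V => v ∈ W)).card = Fintype.card F ^ Module.finrank F W := by
  rw [← Fintype.card_subtype]
  have := Module.natCard_eq_pow_finrank (K := F) (V := W)
  rw [Nat.card_eq_fintype_card, Nat.card_eq_fintype_card] at this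
  rw [← this]

open Classical in
lemma card_sdiff' {F V : Type*} [Field F] [Fintype F] [AddCommGroup V] [Module F V]
    [FiniteDimensional F V] [Fintype V] (y z : Submodule F V) :
    (((Finset.univ.filter (fun v : V => v ∈ z ∧ v ∉ y)).card : ℕ) : ℝ)
      = (Fintype.card F : ℝ) ^ Module.finrank F z
        - (Fintype.card F : ℝ) ^ Module.finrank F ↥(y ⊓ z) := by
  have h := Finset.card_filter_add_card_filter_not (s := Finset.univ.filter (fun v : V => v ∈ z)) (fun v => v ∈ y)
  rw [Finset.filter_filter, Finset.filter_filter, card_sub] at h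
  have h2 : (Finset.univ.filter (fun v : V => v ∈ z ∧ v ∈ y)).card = Fintype.card F ^ Module.finrank F ↥(y ⊓ z) := by
    rw [← card_sub]; congr 1; ext v; simp [and_comm]
  rw [h2] at h
  rw [eq_sub_iff_add_eq]; rw [add_comm]; exact_mod_cast h

open Classical in
lemma card_fun {F V : Type*} [Field F] [Fintype F] [AddCommGroup V] [Module F V]
    [FiniteDimensional F V] [Fintype (Module.Dual F V)] (W : Submodule F V) :
    (((Finset.univ.filter (fun f : Module.Dual F V => f ≠ 0 ∧ f ∈ W.dualAnnihilator)).card : ℕ) : ℝ)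
      = (Fintype.card F : ℝ) ^ (Module.finrank F V - Module.finrank F W) - 1 := by
  have h := card_sdiff' (F := F) (⊥ : Submodule F (Module.Dual F V)) W.dualAnnihilator
  have h2 := Subspace.finrank_add_finrank_dualAnnihilator_eq W
  have h3 : Module.finrank F W.dualAnnihilator = Module.finrank F V - Module.finrank F W := by omega
  rw [h3, bot_inf_eq, finrank_bot, pow_zero] at h
  rw [← h]; congr 2; ext f; simp [and_comm]

lemma finrank_comap' {F V : Type*} [Field F] [AddCommGroup V] [Module F V]
    (y z : Submodule F V) :
    Module.finrank F (Submodule.comap y.subtype z) = Module.finrank F ↥(y ⊓ z) := by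
  rw [← Submodule.map_comap_subtype, Submodule.finrank_map_subtype_eq]

/-- Let `α` be an `i`-dimensional subspace of `V` with `0 ≤ i ≤ D`, and let `y` be a
`D`-dimensional subspace of `V` with `α ⊆ y`. Then the number of `D`-dimensional subspaces
`z` of `V` with `α ⊆ z` and `dim(y ∩ z) = D - 1` equals `q[D-i][N-D]`. -/
theorem stmt18 (q : ℕ) (F : Type*) [Field F] [Fintype F] (hF : Fintype.card F = q)
    (N D : ℕ) (hD : 1 ≤ D) (hND : D < N)
    (V : Type*) [AddCommGroup V] [Module F V] [FiniteDimensional F V]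
    (hV : Module.finrank F V = N)
    (i : ℕ) (hiD : i ≤ D)
    (α : Submodule F V) (hα : Module.finrank F ↥α = i)
    (y : Submodule F V) (hy : Module.finrank F ↥y = D) (hαy : α ≤ y) :
    (Nat.card {z : Submodule F V // Module.finrank F ↥z = D ∧ α ≤ z ∧
        Module.finrank F ↥(y ⊓ z) = D - 1} : ℝ)
      = (q : ℝ) * qInt q ((D : ℤ) - i) * qInt q ((N : ℤ) - D) := by
  classical
  have : Finite V := Module.finite_of_finite F
  have : Fintype V := Fintype.ofFinite V
  have : Finite (Submodule F V) := Finite.of_injective (fun z => (z : Set V)) SetLike.coe_injective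
  have : Fintype (Submodule F V) := Fintype.ofFinite _
  have : Finite (Module.Dual F y) := Module.finite_of_finite F
  have : Fintype (Module.Dual F y) := Fintype.ofFinite _
  set X : Finset (Submodule F V) := Finset.univ.filter (fun z => Module.finrank F ↥z = D ∧ α ≤ z ∧
        Module.finrank F ↥(y ⊓ z) = D - 1) with hX
  have hcard : Nat.card {z : Submodule F V // Module.finrank F ↥z = D ∧ α ≤ z ∧
        Module.finrank F ↥(y ⊓ z) = D - 1} = X.card := by
    rw [Nat.card_eq_fintype_card, Fintype.card_subtype]
  rw [hcard]
  set A := Finset.univ.filter (fun f : Module.Dual F y =>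
    f ≠ 0 ∧ f ∈ (Submodule.comap y.subtype α).dualAnnihilator) with hA
  set B := Finset.univ.filter (fun v : V => v ∈ (⊤ : Submodule F V) ∧ v ∉ y) with hB
  have hAc : (A.card : ℝ) = (q : ℝ) ^ (D - i) - 1 := by
    have h := card_fun (F := F) (Submodule.comap y.subtype α)
    rw [finrank_comap', inf_eq_right.2 hαy, hα, hy, hF] at h
    rw [← h, hA]
    congr!
  have hBc : (B.card : ℝ) = (q : ℝ) ^ N - (q : ℝ) ^ D := by
    rw [hB, card_sdiff', inf_top_eq, finrank_top, hV, hy, hF]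
  let r : Module.Dual F y × V → Submodule F V → Prop := fun p z =>
    p.1 ∈ (Submodule.comap y.subtype z).dualAnnihilator ∧ p.2 ∈ z
  set C : Submodule F V → Finset (Module.Dual F y) := fun z => Finset.univ.filter
    (fun f : Module.Dual F y => f ≠ 0 ∧ f ∈ (Submodule.comap y.subtype z).dualAnnihilator) with hC
  set E : Submodule F V → Finset V := fun z => Finset.univ.filter
    (fun v : V => v ∈ z ∧ v ∉ y) with hE
  have h1 : ∀ p ∈ A ×ˢ B, (X.bipartiteAbove r p).card = 1 := by
    rintro ⟨f, v⟩ hp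
    simp only [hA, hB, Finset.mem_product, Finset.mem_filter, Finset.mem_univ, true_and,
      Submodule.mem_top] at hp
    obtain ⟨⟨hf0, hfα⟩, hv⟩ := hp
    rw [Finset.card_eq_one]
    have hk := Module.Dual.finrank_ker_add_one_of_ne_zero hf0
    set H : Submodule F V := (LinearMap.ker f).map y.subtype with hH
    have hHy : H ≤ y := Submodule.map_subtype_le _ _
    have hHf : Module.finrank F H + 1 = D := by
      rw [hH, Submodule.finrank_map_subtype_eq, hk, hy]
    have hz := Submodule.finrank_sup_span_singleton (K := F) (p := H) (v := v) (fun h => hv (hHy h))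
    have hyv := Submodule.finrank_sup_span_singleton (K := F) (p := y) (v := v) hv
    have hsup : y ⊔ (H ⊔ Submodule.span F {v}) = y ⊔ Submodule.span F {v} := by
      rw [← sup_assoc, sup_eq_left.2 hHy]
    have hinf := Submodule.finrank_sup_add_finrank_inf_eq y (H ⊔ Submodule.span F {v})
    rw [hsup] at hinf
    have hyz : Module.finrank F ↥(y ⊓ (H ⊔ Submodule.span F {v})) = D - 1 := by omega
    have hyzH : H = y ⊓ (H ⊔ Submodule.span F {v}) :=
      Submodule.eq_of_le_of_finrank_eq (le_inf hHy le_sup_left) (by omega)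
    refine ⟨H ⊔ Submodule.span F {v}, ?_⟩
    ext z
    simp only [Finset.mem_bipartiteAbove, hX, Finset.mem_filter, Finset.mem_univ, true_and,
      Finset.mem_singleton, r]
    constructor
    · rintro ⟨⟨hzD, hαz, hyzD⟩, hfz, hvz⟩
      have hle : y ⊓ z ≤ H := by
        intro w hw
        refine ⟨⟨w, hw.1⟩, ?_, rfl⟩
        exact (Submodule.mem_dualAnnihilator f).1 hfz ⟨w, hw.1⟩ hw.2
      have heq : y ⊓ z = H := Submodule.eq_of_le_of_finrank_eq hle (by omega)
      symm
      apply Submodule.eq_of_le_of_finrank_eq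
      · refine sup_le (heq ▸ inf_le_right) ?_
        rwa [Submodule.span_singleton_le_iff_mem]
      · omega
    · rintro rfl
      refine ⟨⟨by omega, ?_, hyz⟩, ?_, ?_⟩
      · refine le_trans ?_ le_sup_left
        intro a ha
        exact ⟨⟨a, hαy ha⟩, (Submodule.mem_dualAnnihilator f).1 hfα ⟨a, hαy ha⟩ ha, rfl⟩
      · rw [Submodule.mem_dualAnnihilator]
        intro w hw
        have : (w : V) ∈ H := by rw [hyzH]; exact ⟨w.2, hw⟩
        obtain ⟨u, hu, huw⟩ := this
        have : u = w := Subtype.ext huw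
        exact this ▸ hu
      · exact (le_sup_right : _ ≤ H ⊔ Submodule.span F {v}) (Submodule.mem_span_singleton_self v)
  have hb : ∀ z ∈ X, (A ×ˢ B).bipartiteBelow r z = C z ×ˢ E z := by
    intro z hz
    simp only [hX, Finset.mem_filter, Finset.mem_univ, true_and] at hz
    obtain ⟨-, hαz, -⟩ := hz
    ext ⟨f, v⟩
    have : (Submodule.comap y.subtype z).dualAnnihilator ≤
        (Submodule.comap y.subtype α).dualAnnihilator :=
      Submodule.dualAnnihilator_anti (Submodule.comap_mono hαz)
    have := @this f
    simp only [Finset.mem_bipartiteBelow, hA, hB, hC, hE, Finset.mem_product, Finset.mem_filter,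
      Finset.mem_univ, true_and, Submodule.mem_top, r]
    tauto
  have hCE : ∀ z ∈ X, (((A ×ˢ B).bipartiteBelow r z).card : ℝ)
      = ((q : ℝ) - 1) * ((q : ℝ) ^ D - (q : ℝ) ^ (D - 1)) := by
    intro z hz
    rw [hb z hz, Finset.card_product, Nat.cast_mul]
    simp only [hX, Finset.mem_filter, Finset.mem_univ, true_and] at hz
    obtain ⟨hzD, hαz, hyz⟩ := hz
    have h := card_fun (F := F) (Submodule.comap y.subtype z)
    rw [finrank_comap', hyz, hF, hy, show D - (D - 1) = 1 by omega, pow_one] at h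
    have h' := card_sdiff' y z
    rw [hyz, hzD, hF] at h'
    rw [← h, ← h', hC, hE]
    congr!
  have hdc := Finset.sum_card_bipartiteAbove_eq_sum_card_bipartiteBelow (s := A ×ˢ B) (t := X) r
  rw [Finset.sum_congr rfl h1] at hdc
  have hdc' : (((A ×ˢ B).card : ℕ) : ℝ) =
      X.card * (((q : ℝ) - 1) * ((q : ℝ) ^ D - (q : ℝ) ^ (D - 1))) := by
    have := congrArg (Nat.cast (R := ℝ)) hdc
    rw [Nat.cast_sum (R := ℝ) X, Finset.sum_congr rfl hCE] at this
    simpa using this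
  rw [Finset.card_product, Nat.cast_mul, hAc, hBc] at hdc'
  have hq : (1 : ℝ) < q := by
    rw [← hF]; exact_mod_cast Fintype.one_lt_card
  unfold qInt
  rw [show (D : ℤ) - i = ((D - i : ℕ) : ℤ) by omega, show (N : ℤ) - D = ((N - D : ℕ) : ℤ) by omega,
    zpow_natCast, zpow_natCast]
  obtain ⟨d, rfl⟩ : ∃ d, D = d + 1 := ⟨D - 1, by omega⟩
  obtain ⟨m, rfl⟩ : ∃ m, N = d + 1 + m := ⟨N - (d + 1), by omega⟩
  simp only [Nat.add_sub_cancel, Nat.add_sub_cancel_left] at hdc' ⊢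
  have hq1 : (q : ℝ) - 1 ≠ 0 := by linarith
  have hqd : (q : ℝ) ^ d ≠ 0 := by positivity
  field_simp
  apply mul_left_cancel₀ hqd
  rw [pow_add, pow_succ] at hdc'
  linear_combination -hdc'
end

section
/- Assume N > 2D, fix a vertex x ∈ X, and let α ⊆ x be a subspace with dim α = i. Then every y ∈ X with y ∩ x = α has exactly [D−i](q[N−D]−[D−i]) neighbors z ∈ X (i.e., z with dim(y ∩ z) = D−1) satisfying z ∩ x = α; that is, the subgraph of J_q(N,D) induced on G_α = {y ∈ X : y ∩ x = α} is regular of valency [D−i](q[N−D]−[D−i]). -/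
open Module in
theorem aux_card {F : Type*} [Field F] [Fintype F] {V : Type*} [AddCommGroup V] [Module F V]
    [FiniteDimensional F V] (p : Submodule F V) :
    (p : Set V).ncard = Fintype.card F ^ finrank F p := by
  rw [← Nat.card_eq_fintype_card, ← Module.natCard_eq_pow_finrank (K := F) (V := p)]
  rfl

open Module in
theorem aux_ker {F : Type*} [Field F] {V : Type*} [AddCommGroup V] [Module F V]
    [FiniteDimensional F V] (y : Submodule F V) (f : Dual F y) (hf : f ≠ 0) :
    finrank F ((LinearMap.ker f).map y.subtype) + 1 = finrank F y := by
  rw [Submodule.finrank_map_subtype_eq]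
  exact Module.Dual.finrank_ker_add_one_of_ne_zero hf

open Module in
theorem aux_ann {F : Type*} [Field F] {V : Type*} [AddCommGroup V] [Module F V]
    [FiniteDimensional F V] (y a : Submodule F V) (h : a ≤ y) :
    finrank F (a.comap y.subtype).dualAnnihilator + finrank F a = finrank F y := by
  have h1 := Subspace.finrank_add_finrank_dualAnnihilator_eq (a.comap y.subtype)
  have h2 := (Submodule.comapSubtypeEquivOfLe h).finrank_eq
  omega

theorem aux_sup {F : Type*} [Field F] {V : Type*} [AddCommGroup V] [Module F V]
    [FiniteDimensional F V] (w : Submodule F V) (v : V) (h : v ∉ w) :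
    Module.finrank F ↥(w ⊔ Submodule.span F {v}) = Module.finrank F w + 1 := by
  have hv : v ≠ 0 := by rintro rfl; exact h w.zero_mem
  have h1 := Submodule.finrank_sup_add_finrank_inf_eq w (Submodule.span F {v})
  have h2 : w ⊓ Submodule.span F {v} = ⊥ := by
    rw [← disjoint_iff, Submodule.disjoint_span_singleton' hv]
    exact h
  rw [h2, finrank_bot, finrank_span_singleton hv] at h1
  omega

theorem aux_fib {A B : Type*} [Finite A] [Finite B] (S : Set A) (T : Set B) (g : A → B)
    (hg : ∀ a ∈ S, g a ∈ T) (c : ℕ) (hc : ∀ b ∈ T, {a | a ∈ S ∧ g a = b}.ncard = c) :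
    S.ncard = T.ncard * c := by
  classical
  have := Fintype.ofFinite A
  have := Fintype.ofFinite B
  rw [Set.ncard_eq_toFinset_card', Set.ncard_eq_toFinset_card',
    Finset.card_eq_sum_card_fiberwise (f := g) (t := T.toFinset) (by intro a; simpa using hg a)]
  rw [Finset.sum_const_nat (m := c)]
  intro b hb
  rw [← hc b (by simpa using hb), Set.ncard_eq_toFinset_card']
  congr 1
  ext a
  simp

theorem aux_nz {F : Type*} [Field F] [Fintype F] {V : Type*} [AddCommGroup V] [Module F V]
    [FiniteDimensional F V] (p : Submodule F V) :
    {v | v ∈ p ∧ v ≠ 0}.ncard = Fintype.card F ^ Module.finrank F p - 1 := by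
  have := Module.finite_of_finite F (M := V)
  rw [← aux_card, ← Set.ncard_singleton (0 : V), ← Set.ncard_sdiff (by simp)]
  rfl

theorem aux_compl {F : Type*} [Field F] [Fintype F] {V : Type*} [AddCommGroup V] [Module F V]
    [FiniteDimensional F V] (p r : Submodule F V) :
    {v | v ∉ r ∧ v ∉ p}.ncard + Fintype.card F ^ Module.finrank F p
      + Fintype.card F ^ Module.finrank F r
      = Fintype.card F ^ Module.finrank F V
      + Fintype.card F ^ Module.finrank F ↥(p ⊓ r) := by
  have := Module.finite_of_finite F (M := V)
  have h1 := Set.ncard_union_add_ncard_inter (p : Set V) (r : Set V)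
  have h2 := Set.ncard_add_ncard_compl ((p : Set V) ∪ r)
  have h3 : ((p : Set V) ∪ r)ᶜ = {v | v ∉ r ∧ v ∉ p} := by
    ext v; simp; tauto
  have h4 : (p : Set V) ∩ r = ((p ⊓ r : Submodule F V) : Set V) := rfl
  rw [h4, aux_card, aux_card, aux_card] at h1
  rw [h3, Module.natCard_eq_pow_finrank (K := F), Nat.card_eq_fintype_card] at h2
  omega

/-- Assume `N > 2D`, fix a vertex `x` of the Grassmann graph `J_q(N,D)`, and let `α ⊆ x` be a
subspace with `dim α = i`. Then every vertex `y` with `y ∩ x = α` has exactly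
`[D-i](q[N-D]-[D-i])` neighbors `z` (i.e. `dim(y ∩ z) = D-1`) with `z ∩ x = α`; that is, the
subgraph induced on `G_α = {y : y ∩ x = α}` is regular of valency `[D-i](q[N-D]-[D-i])`. -/
theorem stmt19 (q : ℕ) (F : Type*) [Field F] [Fintype F] (hF : Fintype.card F = q)
    (N D : ℕ) (hD : 1 ≤ D) (hND : 2 * D < N)
    (V : Type*) [AddCommGroup V] [Module F V] [FiniteDimensional F V]
    (hV : Module.finrank F V = N)
    (x : Submodule F V) (hx : Module.finrank F ↥x = D)
    (α : Submodule F V) (hαx : α ≤ x) (i : ℕ) (hi : Module.finrank F ↥α = i)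
    (y : Submodule F V) (hy : Module.finrank F ↥y = D) (hyx : y ⊓ x = α) :
    (Nat.card {z : Submodule F V // Module.finrank F ↥z = D ∧
        Module.finrank F ↥(y ⊓ z) = D - 1 ∧ z ⊓ x = α} : ℝ)
      = qInt q ((D : ℤ) - i) * ((q : ℝ) * qInt q ((N : ℤ) - D) - qInt q ((D : ℤ) - i)) := by
  classical
  have hVf := Module.finite_of_finite F (M := V)
  have hDf : Finite (Module.Dual F y) := Module.finite_of_finite F
  have hSf : Finite (Submodule F V) := Finite.of_injective _ SetLike.coe_injective
  have hiD : i ≤ D := by rw [← hi, ← hx]; exact Submodule.finrank_mono hαx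
  have hαy : α ≤ y := by rw [← hyx]; exact inf_le_left
  set W : Module.Dual F y → Submodule F V := fun f => (LinearMap.ker f).map y.subtype with hW
  have hWy : ∀ f, W f ≤ y := fun f => Submodule.map_subtype_le _ _
  have hWD : ∀ f, f ≠ 0 → Module.finrank F (W f) + 1 = D := fun f hf => by
    rw [← hy]; exact aux_ker y f hf
  have hWle : ∀ (a : Submodule F V) (f : Module.Dual F y), a ≤ y →
      (f ∈ (a.comap y.subtype).dualAnnihilator ↔ a ≤ W f) := by
    intro a f ha
    rw [Submodule.mem_dualAnnihilator]
    constructor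
    · intro h v hv
      exact ⟨⟨v, ha hv⟩, h _ hv, rfl⟩
    · rintro h ⟨v, hvy⟩ hv
      obtain ⟨u, hu, huv⟩ := h hv
      have : u = ⟨v, hvy⟩ := Subtype.ext huv
      rw [← this]; exact hu
  have hWx : ∀ f, α ≤ W f → W f ⊓ x = α := fun f hf =>
    le_antisymm (by rw [← hyx]; exact inf_le_inf_right _ (hWy f)) (le_inf hf hαx)
  set P : Set (Module.Dual F y) := {f | f ∈ (α.comap y.subtype).dualAnnihilator ∧ f ≠ 0} with hP
  set Z : Set (Submodule F V) := {z | Module.finrank F ↥z = D ∧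
        Module.finrank F ↥(y ⊓ z) = D - 1 ∧ z ⊓ x = α} with hZ
  set T : Set (Module.Dual F y × V) := {p | p.1 ∈ P ∧ p.2 ∉ y ∧ p.2 ∉ x ⊔ W p.1} with hT
  have hPc : P.ncard = q ^ (D - i) - 1 := by
    rw [hP, aux_nz, hF]
    have := aux_ann y α hαy
    congr 2; omega
  have key : ∀ f v, f ∈ P → v ∉ y → v ∉ x ⊔ W f →
      W f ⊔ Submodule.span F {v} ∈ Z ∧ y ⊓ (W f ⊔ Submodule.span F {v}) = W f := by
    rintro f v ⟨hf1, hf0⟩ hvy hvx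
    rw [hWle _ _ hαy] at hf1
    have hvW : v ∉ W f := fun h => hvy (hWy f h)
    have h1 := aux_sup _ _ hvW
    have h2 : y ⊓ (W f ⊔ Submodule.span F {v}) = W f := by
      refine le_antisymm ?_ (le_inf (hWy f) le_sup_left)
      rintro u ⟨huy, hu⟩
      obtain ⟨a, ha, b, hb, rfl⟩ := Submodule.mem_sup.1 hu
      obtain ⟨c, rfl⟩ := Submodule.mem_span_singleton.1 hb
      by_cases hc : c = 0
      · simpa [hc] using ha
      · exact absurd ((Submodule.smul_mem_iff y hc).1
          ((Submodule.add_mem_iff_right y (hWy f ha)).1 huy)) hvy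
    have h3 := hWD f hf0
    refine ⟨⟨by omega, by rw [h2]; omega, ?_⟩, h2⟩
    refine le_antisymm ?_ (le_inf (hf1.trans le_sup_left) hαx)
    rintro u ⟨hu, hux⟩
    obtain ⟨a, ha, b, hb, rfl⟩ := Submodule.mem_sup.1 hu
    obtain ⟨c, rfl⟩ := Submodule.mem_span_singleton.1 hb
    by_cases hc : c = 0
    · rw [← hWx f hf1]
      exact ⟨by simpa [hc] using ha, hux⟩
    · refine absurd ((Submodule.smul_mem_iff _ hc).1
          ((Submodule.add_mem_iff_right (x ⊔ W f) (Submodule.mem_sup_right ha)).1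
            (Submodule.mem_sup_left hux))) hvx
  set c1 : ℕ := q ^ N + q ^ (D - 1) - q ^ (2 * D - 1 - i) - q ^ D with hc1
  have hcomp : ∀ f ∈ P, {v | v ∉ y ∧ v ∉ x ⊔ W f}.ncard + q ^ (2 * D - 1 - i) + q ^ D
      = q ^ N + q ^ (D - 1) := by
    rintro f ⟨hf1, hf0⟩
    rw [hWle _ _ hαy] at hf1
    have h := aux_compl (x ⊔ W f) y
    have h1 : (x ⊔ W f) ⊓ y = W f := by
      rw [sup_comm, sup_inf_assoc_of_le x (hWy f), inf_comm x y, hyx]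
      exact sup_eq_left.2 hf1
    have h2 := Submodule.finrank_sup_add_finrank_inf_eq x (W f)
    rw [inf_comm, hWx f hf1, hi, hx] at h2
    have h3 := hWD f hf0
    rw [h1, hF, hV, hy] at h
    rw [show Module.finrank F ↥(x ⊔ W f) = 2 * D - 1 - i by omega,
      show Module.finrank F ↥(W f) = D - 1 by omega] at h
    exact h
  have hT1 : T.ncard = P.ncard * c1 := by
    refine aux_fib T P Prod.fst (fun a ha => ha.1) c1 ?_
    intro f hf
    have : {a | a ∈ T ∧ a.1 = f} = Prod.mk f '' {v | v ∉ y ∧ v ∉ x ⊔ W f} := by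
      ext ⟨g, v⟩
      constructor
      · rintro ⟨⟨_, h1, h2⟩, rfl⟩
        exact ⟨v, ⟨h1, h2⟩, rfl⟩
      · rintro ⟨u, ⟨h1, h2⟩, h⟩
        obtain ⟨rfl, rfl⟩ := Prod.mk.inj h
        exact ⟨⟨hf, h1, h2⟩, rfl⟩
    rw [this, Set.ncard_image_of_injective _ (Prod.mk_right_injective f)]
    have := hcomp f hf
    omega
  have hT2 : T.ncard = Z.ncard * ((q - 1) * (q ^ D - q ^ (D - 1))) := by
    refine aux_fib T Z (fun p => W p.1 ⊔ Submodule.span F {p.2})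
      (fun a ha => (key _ _ ha.1 ha.2.1 ha.2.2).1) _ ?_
    rintro z hz
    obtain ⟨hz1, hz2, hz3⟩ := id hz
    have hαz : α ≤ z := by rw [← hz3]; exact inf_le_left
    have : {a | a ∈ T ∧ W a.1 ⊔ Submodule.span F {a.2} = z} =
        {f | f ∈ ((y ⊓ z).comap y.subtype).dualAnnihilator ∧ f ≠ 0} ×ˢ
          ((z : Set V) \ ((y ⊓ z : Submodule F V) : Set V)) := by
      ext ⟨f, v⟩
      constructor
      · rintro ⟨⟨h0, h1, h2⟩, h3⟩
        dsimp only at h0 h1 h2 h3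
        have h4 := (key f v h0 h1 h2).2
        rw [h3] at h4
        refine ⟨⟨(hWle _ _ inf_le_left).2 h4.le, h0.2⟩, ?_, fun h => h1 h.1⟩
        rw [← h3]
        exact Submodule.mem_sup_right (Submodule.mem_span_singleton_self v)
      · rintro ⟨⟨h0, hf0⟩, hvz, hvy'⟩
        dsimp only at h0 hf0 hvz hvy'
        have hvy : v ∉ y := fun h => hvy' ⟨h, hvz⟩
        rw [hWle _ _ inf_le_left] at h0
        have h3 := hWD f hf0
        have h4 : y ⊓ z = W f := Submodule.eq_of_le_of_finrank_eq h0 (by omega)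
        have hWz : W f ≤ z := by rw [← h4]; exact inf_le_right
        have hαW : α ≤ W f := by rw [← h4]; exact le_inf hαy hαz
        refine ⟨⟨⟨(hWle _ _ hαy).2 hαW, hf0⟩, hvy, ?_⟩, ?_⟩
        · intro h
          obtain ⟨a, ha, b, hb, hab⟩ := Submodule.mem_sup.1 h
          dsimp only at hab hb
          apply hvy
          have haz : a ∈ z := by
            rw [← hab] at hvz
            exact (Submodule.add_mem_iff_left z (hWz hb)).1 hvz
          rw [← hab]
          refine y.add_mem (hαy ?_) (hWy f hb)
          rw [← hz3]; exact ⟨haz, ha⟩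
        · have h5 := aux_sup (W f) v (fun h => hvy (hWy f h))
          refine Submodule.eq_of_le_of_finrank_eq (sup_le hWz ?_) (by dsimp only; omega)
          rw [Submodule.span_singleton_le_iff_mem]; exact hvz
    rw [this, Set.ncard_prod, aux_nz, Set.ncard_sdiff (fun _ h => h.2), aux_card, aux_card, hF,
      hz1, hz2]
    have := aux_ann y (y ⊓ z) inf_le_left
    rw [show Module.finrank F ((y ⊓ z).comap y.subtype).dualAnnihilator = 1 by omega, pow_one]
  have hq : 1 < q := by rw [← hF]; exact Fintype.one_lt_card
  have hZc : Nat.card {z : Submodule F V // Module.finrank F ↥z = D ∧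
        Module.finrank F ↥(y ⊓ z) = D - 1 ∧ z ⊓ x = α} = Z.ncard := rfl
  rw [hZc]
  have hq0 : (q : ℝ) ≠ 0 := by positivity
  have hq1 : (q : ℝ) - 1 ≠ 0 := by
    have : (1 : ℝ) < q := by exact_mod_cast hq
    linarith
  have e := hT1.symm.trans hT2
  rw [hPc] at e
  clear_value Z
  clear hT1 hT2 hcomp key hPc
  obtain ⟨m, rfl⟩ := Nat.exists_eq_add_of_le hiD
  obtain ⟨k, rfl⟩ : ∃ k, N = (i + m) + k := ⟨N - (i + m), by omega⟩
  have hcc : c1 + q ^ (2 * (i + m) - 1 - i) + q ^ (i + m) = q ^ (i + m + k) + q ^ (i + m - 1) := by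
    have h1 : q ^ (2 * (i + m) - 1 - i) ≤ q ^ (i + m + k - 1) :=
      Nat.pow_le_pow_right hq.le (by omega)
    have h2 : q ^ (i + m) ≤ q ^ (i + m + k - 1) :=
      Nat.pow_le_pow_right hq.le (by omega)
    have h3 : q ^ (i + m + k) = q ^ (i + m + k - 1) * q := by
      rw [← pow_succ]; congr 1; omega
    have h4 : q ^ (i + m + k - 1) * 2 ≤ q ^ (i + m + k - 1) * q := Nat.mul_le_mul_left _ hq
    omega
  clear_value c1
  have hp : q ^ (i + m - 1) * q = q ^ (i + m) := by rw [← pow_succ]; congr 1; omega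
  have e' : ((q : ℝ) ^ m - 1) * c1 = Z.ncard * ((q - 1) * (q ^ (i + m) - q ^ (i + m - 1))) := by
    have h1 : 1 ≤ q ^ m := Nat.one_le_pow _ _ (by omega)
    have h2 : q ^ (i + m - 1) ≤ q ^ (i + m) := Nat.pow_le_pow_right hq.le (by omega)
    have := congrArg (Nat.cast (R := ℝ)) e
    rw [show i + m - i = m by omega] at this
    push_cast [Nat.cast_sub h1, Nat.cast_sub h2, Nat.cast_sub hq.le] at this
    exact this
  have hcc' : (c1 : ℝ) = q ^ (i + m - 1) * (q ^ k * q + 1 - q ^ m - q) := by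
    have h1 : q ^ (2 * (i + m) - 1 - i) = q ^ (i + m - 1) * q ^ m := by
      rw [← pow_add]; congr 1; omega
    have h2 : q ^ (i + m + k) = q ^ (i + m - 1) * (q ^ k * q) := by
      rw [pow_add, ← hp]; ring
    rw [h1, h2, ← hp] at hcc
    have := congrArg (Nat.cast (R := ℝ)) hcc
    push_cast at this
    linarith
  have hp' : (q : ℝ) ^ (i + m) = q ^ (i + m - 1) * q := by exact_mod_cast hp.symm
  rw [hcc', hp'] at e'
  have hr : (q : ℝ) ^ (i + m - 1) ≠ 0 := pow_ne_zero _ hq0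
  have e2 : ((q : ℝ) ^ m - 1) * (q ^ k * q + 1 - q ^ m - q) = Z.ncard * ((q - 1) * (q - 1)) := by
    apply mul_left_cancel₀ hr
    linarith
  unfold qInt
  rw [show ((i + m : ℕ) : ℤ) - i = (m : ℕ) by push_cast; ring,
    show ((i + m + k : ℕ) : ℤ) - (i + m : ℕ) = (k : ℕ) by push_cast; ring, zpow_natCast,
    zpow_natCast]
  field_simp
  linarith
end
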